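/- Let d ≥ 1 and 2 ≤ p < ∞. There is a constant C (depending only on d and p) such that for all n ∈ ℕ and all 1 ≤ m ≤ |Q_n|, the Kolmogorov numbers of the step hyperbolic cross projection satisfy d_m(S_{Q_n} : L_p(𝕋^d) → L_∞(𝕋^d)) ≤ C (2^n/m)^{1/p} n^{(d−1)(1−1/p) + 1/p}. -/

import Mathlib

open MeasureTheory Real
open scoped ENNReal ComplexConjugate Classical

noncomputable section

instance : Fact (0 < 2 * π) := ⟨by positivity⟩

/-- The `d`-dimensional torus `[0, 2π]^d`. -/
abbrev Torus (d : ℕ) := Fin d → AddCircle (2 * π)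

/-- The multivariate trigonometric character `x ↦ e^{i k · x}`. -/
def trigChar {d : ℕ} (k : Fin d → ℤ) : C(Torus d, ℂ) :=
  ⟨fun x => ∏ j, fourier (k j) (x j),
    continuous_finset_prod _ fun j _ => (map_continuous (fourier (k j))).comp (continuous_apply j)⟩

/-- The Fourier coefficient `f̂(k) = (2π)^{-d} ∫ f(x) e^{-i k·x} dx`. -/
def fCoeff {d : ℕ} (f : Torus d → ℂ) (k : Fin d → ℤ) : ℂ :=
  ((2 * π) ^ d)⁻¹ • ∫ x : Torus d, conj (trigChar k x) * f x

/-- A continuous function on the torus, considered as an element of `L_∞`. -/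
def toLinfty {d : ℕ} (g : C(Torus d, ℂ)) : Lp ℂ ∞ (volume : Measure (Torus d)) :=
  ContinuousMap.toLp ∞ (volume : Measure (Torus d)) ℂ g

/-- The Fourier projection `S_E f = ∑_{k ∈ E} f̂(k) e^{i k·x}`, as an operator from
`L_q(𝕋^d)` to `L_∞(𝕋^d)`. -/
def SE (d : ℕ) (q : ℝ≥0∞) (E : Finset (Fin d → ℤ))
    (f : Lp ℂ q (volume : Measure (Torus d))) : Lp ℂ ∞ (volume : Measure (Torus d)) :=
  toLinfty (∑ k ∈ E, fCoeff (f : Torus d → ℂ) k • trigChar k)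

/-- The dyadic block `ρ(s) = {k : ⌊2^{s_j - 1}⌋ ≤ |k_j| < 2^{s_j}, j = 1,…,d}`. -/
def inRho {d : ℕ} (s : Fin d → ℕ) (k : Fin d → ℤ) : Prop :=
  ∀ j, (2 ^ (s j) / 2 : ℤ) ≤ |k j| ∧ |k j| < 2 ^ (s j)

/-- The step hyperbolic cross `Q_n = ⋃_{‖s‖₁ ≤ n} ρ(s)` as a finite set of frequencies. -/
def hypCross (d n : ℕ) : Finset (Fin d → ℤ) :=
  (Finset.Icc (fun _ => -(2 ^ n : ℤ)) fun _ => (2 ^ n : ℤ)).filter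
    fun k => ∃ s : Fin d → ℕ, (∑ j, s j) ≤ n ∧ inRho s k

/-- Kolmogorov numbers. -/
noncomputable def dK {A B : Type*} [Norm A] [NormedAddCommGroup B] [NormedSpace ℂ B]
    (T : A → B) (m : ℕ) : ℝ :=
  ⨅ L : {L : Submodule ℂ B // FiniteDimensional ℂ L ∧ Module.finrank ℂ L < m},
    ⨆ a : {a : A // ‖a‖ ≤ 1}, ⨅ b : L.1, ‖T a.1 - (b : B)‖

/-! ### Rademacher sums and random sign matrices -/

/-- The sign `±1` encoded by a Boolean. -/
def boolSign (b : Bool) : ℝ := if b then 1 else -1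

/-- The signed sum `∑ₖ εₖ xₖ`. -/
def signSum {n : ℕ} (ε : Fin n → Bool) (x : Fin n → ℝ) : ℝ := ∑ k, boolSign (ε k) * x k

lemma sum_signs_succ {n : ℕ} (F : (Fin (n + 1) → Bool) → ℝ) :
    ∑ ε, F ε = ∑ ε : Fin n → Bool, (F (Fin.cons true ε) + F (Fin.cons false ε)) := by
  rw [← (Fin.consEquiv (fun _ : Fin (n + 1) => Bool)).sum_comp, Fintype.sum_prod_type,
    Fintype.sum_bool, ← Finset.sum_add_distrib]
  rfl

lemma signSum_cons {n : ℕ} (b : Bool) (ε : Fin n → Bool) (x : Fin (n + 1) → ℝ) :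
    signSum (Fin.cons b ε) x = boolSign b * x 0 + signSum ε (fun k => x k.succ) := by
  simp [signSum, Fin.sum_univ_succ]

lemma sum_exp_sq_signSum_le : ∀ (n : ℕ) (x : Fin n → ℝ) (a t : ℝ), 0 ≤ t →
    2 * t * ∑ k, x k ^ 2 < 1 →
    ∑ ε, exp (t * (a + signSum ε x) ^ 2) ≤
      2 ^ n * exp (t / (1 - 2 * t * ∑ k, x k ^ 2) * (a ^ 2 + ∑ k, x k ^ 2)) := by
  intro n
  induction n with
  | zero => intro x a t ht h; simp [signSum]
  | succ n ih =>
    intro x a t ht h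
    rw [sum_signs_succ, Finset.sum_add_distrib]
    simp only [signSum_cons, boolSign, if_true, Bool.false_eq_true, if_false]
    rw [Fin.sum_univ_succ] at h ⊢
    set σ := ∑ k : Fin n, x k.succ ^ 2 with hσ
    have hx : 0 ≤ x 0 ^ 2 := sq_nonneg _
    have hD : 2 * t * σ < 1 := by nlinarith [mul_nonneg ht hx]
    have h1 := ih (fun k => x k.succ) (a + x 0) t ht hD
    have h2 := ih (fun k => x k.succ) (a - x 0) t ht hD
    rw [← hσ] at h1 h2
    set D := 1 - 2 * t * σ with hDdef
    have hDpos : 0 < D := by linarith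
    have hD2 : 0 < D - 2 * t * x 0 ^ 2 := by rw [hDdef]; nlinarith
    set τ := t / D with hτ
    have hτ0 : 0 ≤ τ := by positivity
    have hττ : τ + 2 * τ ^ 2 * x 0 ^ 2 ≤ t / (1 - 2 * t * (x 0 ^ 2 + σ)) := by
      have : 1 - 2 * t * (x 0 ^ 2 + σ) = D - 2 * t * x 0 ^ 2 := by rw [hDdef]; ring
      rw [this, le_div_iff₀ hD2]
      have e1 : t = τ * D := by rw [hτ]; field_simp
      have : (τ + 2 * τ ^ 2 * x 0 ^ 2) * (D - 2 * t * x 0 ^ 2) =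
          τ * D - 4 * τ ^ 3 * D * (x 0 ^ 2) ^ 2 := by
        rw [e1]; ring
      rw [this]
      have : 0 ≤ 4 * τ ^ 3 * D * (x 0 ^ 2) ^ 2 := by positivity
      linarith
    have hcosh : exp (τ * ((a + x 0) ^ 2 + σ)) + exp (τ * ((a - x 0) ^ 2 + σ)) ≤
        2 * exp (t / (1 - 2 * t * (x 0 ^ 2 + σ)) * (a ^ 2 + (x 0 ^ 2 + σ))) := by
      have e1 : exp (τ * ((a + x 0) ^ 2 + σ)) + exp (τ * ((a - x 0) ^ 2 + σ)) =
          2 * (exp (τ * (a ^ 2 + x 0 ^ 2 + σ)) * cosh (2 * τ * a * x 0)) := by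
        have e2 : τ * ((a + x 0) ^ 2 + σ) = τ * (a ^ 2 + x 0 ^ 2 + σ) + 2 * τ * a * x 0 := by ring
        have e3 : τ * ((a - x 0) ^ 2 + σ) = τ * (a ^ 2 + x 0 ^ 2 + σ) + -(2 * τ * a * x 0) := by
          ring
        rw [cosh_eq, e2, e3, exp_add, exp_add]
        ring
      rw [e1]
      have h3 := cosh_le_exp_half_sq (2 * τ * a * x 0)
      have h4 : exp (τ * (a ^ 2 + x 0 ^ 2 + σ)) * cosh (2 * τ * a * x 0) ≤
          exp (τ * (a ^ 2 + x 0 ^ 2 + σ) + (2 * τ * a * x 0) ^ 2 / 2) := by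
        rw [exp_add]; gcongr
      refine mul_le_mul_of_nonneg_left (h4.trans (exp_le_exp.mpr ?_)) (by norm_num)
      have hσ0 : 0 ≤ σ := Finset.sum_nonneg fun _ _ => sq_nonneg _
      have hτ1 : τ ≤ t / (1 - 2 * t * (x 0 ^ 2 + σ)) := le_trans (by nlinarith [mul_nonneg (sq_nonneg τ) hx]) hττ
      have h5 := mul_le_mul_of_nonneg_right hττ (sq_nonneg a)
      have h6 := mul_le_mul_of_nonneg_right hτ1 (add_nonneg hx hσ0)
      nlinarith
    calc _ = ∑ ε : Fin n → Bool, exp (t * (a + x 0 + signSum ε fun k => x k.succ) ^ 2) +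
          ∑ ε : Fin n → Bool, exp (t * (a - x 0 + signSum ε fun k => x k.succ) ^ 2) := by
            congr 1 <;> refine Finset.sum_congr rfl fun ε _ => ?_ <;> congr 3 <;> ring
      _ ≤ 2 ^ n * (exp (τ * ((a + x 0) ^ 2 + σ)) + exp (τ * ((a - x 0) ^ 2 + σ))) := by
            rw [mul_add]; exact add_le_add h1 h2
      _ ≤ 2 ^ n * (2 * exp (t / (1 - 2 * t * (x 0 ^ 2 + σ)) * (a ^ 2 + (x 0 ^ 2 + σ)))) := by gcongr
      _ = _ := by ring

lemma sum_sq_signSum : ∀ (n : ℕ) (x : Fin n → ℝ) (a : ℝ),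
    ∑ ε, (a + signSum ε x) ^ 2 = 2 ^ n * (a ^ 2 + ∑ k, x k ^ 2) := by
  intro n
  induction n with
  | zero => intro x a; simp [signSum]
  | succ n ih =>
    intro x a
    rw [sum_signs_succ, Finset.sum_add_distrib]
    simp only [signSum_cons, boolSign, if_true, Bool.false_eq_true, if_false, ← add_assoc]
    rw [ih, ih, Fin.sum_univ_succ]
    ring

lemma sum_pow_four_signSum_le : ∀ (n : ℕ) (x : Fin n → ℝ) (a : ℝ),
    ∑ ε, (a + signSum ε x) ^ 4 ≤
      2 ^ n * (a ^ 4 + 6 * a ^ 2 * (∑ k, x k ^ 2) + 3 * (∑ k, x k ^ 2) ^ 2) := by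
  intro n
  induction n with
  | zero => intro x a; simp [signSum]
  | succ n ih =>
    intro x a
    rw [sum_signs_succ, Finset.sum_add_distrib]
    simp only [signSum_cons, boolSign, if_true, Bool.false_eq_true, if_false, ← add_assoc]
    refine (add_le_add (ih _ _) (ih _ _)).trans ?_
    rw [Fin.sum_univ_succ, ← mul_add, pow_succ (2 : ℝ) n, mul_assoc (2 ^ n) 2]
    refine mul_le_mul_of_nonneg_left ?_ (by positivity)
    nlinarith [sq_nonneg (x 0 ^ 2)]

lemma exp_neg_le_quadratic {u : ℝ} (hu : 0 ≤ u) : exp (-u) ≤ 1 - u + u ^ 2 / 2 := by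
  have h := quadratic_le_exp_of_nonneg hu
  have h1 : 0 < 1 - u + u ^ 2 / 2 := by nlinarith [sq_nonneg (u - 1)]
  rw [exp_neg, inv_le_comm₀ (exp_pos u) h1]
  refine le_trans ?_ h
  rw [inv_le_iff_one_le_mul₀ h1]
  nlinarith [sq_nonneg (u ^ 2)]

lemma sum_exp_neg_sq_signSum_le {n : ℕ} (x : Fin n → ℝ) (h : 0 < ∑ k, x k ^ 2) :
    ∑ ε, exp (-(signSum ε x ^ 2 / (3 * ∑ k, x k ^ 2))) ≤ 2 ^ n * exp (-(1 / 6)) := by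
  set σ := ∑ k, x k ^ 2 with hσ
  have h2 := sum_sq_signSum n x 0
  have h4 := sum_pow_four_signSum_le n x 0
  simp only [zero_add, ← hσ] at h2 h4
  calc _ ≤ ∑ ε, (1 - (signSum ε x) ^ 2 / (3 * σ) + ((signSum ε x) ^ 2 / (3 * σ)) ^ 2 / 2) :=
        Finset.sum_le_sum fun ε _ => exp_neg_le_quadratic (by positivity)
    _ = 2 ^ n - (∑ ε, (signSum ε x) ^ 2) / (3 * σ) + (∑ ε, (signSum ε x) ^ 4) / (18 * σ ^ 2) := by
        rw [Finset.sum_add_distrib, Finset.sum_sub_distrib, Finset.sum_div, Finset.sum_div]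
        congr 1
        · simp
        · refine Finset.sum_congr rfl fun ε _ => ?_
          field_simp; ring
    _ ≤ 2 ^ n - (2 ^ n * (0 ^ 2 + σ)) / (3 * σ) +
          (2 ^ n * (0 ^ 4 + 6 * 0 ^ 2 * σ + 3 * σ ^ 2)) / (18 * σ ^ 2) := by
        rw [h2]; gcongr
    _ = 2 ^ n * (5 / 6) := by field_simp; ring
    _ ≤ _ := by
        refine mul_le_mul_of_nonneg_left ?_ (by positivity)
        have := add_one_le_exp (-(1 / 6 : ℝ))
        linarith

lemma card_filter_le_sum_exp {Ω : Type*} [Fintype Ω] (p : Ω → Prop) (g : Ω → ℝ)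
    (h : ∀ ω, p ω → 0 ≤ g ω) :
    ((Finset.univ.filter p).card : ℝ) ≤ ∑ ω, exp (g ω) := by
  rw [Finset.card_eq_sum_ones, Nat.cast_sum, Finset.sum_filter]
  refine Finset.sum_le_sum fun ω _ => ?_
  split_ifs with hp
  · simpa using h ω hp
  · positivity

lemma card_sum_sq_gt_le {n r : ℕ} (x : Fin n → ℝ) :
    ((Finset.univ.filter fun ε : Fin r → Fin n → Bool =>
      6 * r * ∑ k, x k ^ 2 < ∑ l, signSum (ε l) x ^ 2).card : ℝ) ≤
      (2 ^ n) ^ r * exp (-r) := by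
  set σ := ∑ k, x k ^ 2 with hσ
  have hσ0 : 0 ≤ σ := Finset.sum_nonneg fun k _ => sq_nonneg (x k)
  rcases hσ0.eq_or_lt with h0 | h0
  · have hx : ∀ k, x k = 0 := fun k => by
      have := (Finset.sum_eq_zero_iff_of_nonneg (fun k _ => sq_nonneg (x k))).1 (hσ ▸ h0.symm) k
        (Finset.mem_univ k)
      exact pow_eq_zero_iff (two_ne_zero) |>.1 this
    rw [Finset.filter_false_of_mem]
    · simp; positivity
    · intro ε _
      simp [signSum, hx, ← h0]
  · have key := sum_exp_sq_signSum_le n x 0 (1 / (4 * σ)) (by positivity)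
      (by rw [← hσ]; field_simp; norm_num)
    rw [← hσ] at key
    have e1 : 1 / (4 * σ) / (1 - 2 * (1 / (4 * σ)) * σ) * (0 ^ 2 + σ) = 1 / 2 := by
      have : 1 - 2 * (1 / (4 * σ)) * σ = 1 / 2 := by field_simp; norm_num
      rw [this]; field_simp; norm_num
    rw [e1] at key
    refine (card_filter_le_sum_exp _
      (fun ε => (∑ l, 1 / (4 * σ) * (0 + signSum (ε l) x) ^ 2) + -(3 / 2 * r)) ?_).trans ?_
    · intro ε hε
      rw [← Finset.mul_sum]
      simp only [zero_add]
      have : 1 / (4 * σ) * (6 * r * σ) ≤ 1 / (4 * σ) * ∑ l, signSum (ε l) x ^ 2 := by gcongr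
      have e2 : 1 / (4 * σ) * (6 * r * σ) = 3 / 2 * r := by field_simp; ring
      linarith
    · simp only [exp_add, exp_sum]
      rw [← Finset.sum_mul, ← Fintype.sum_pow (fun ω => exp (1 / (4 * σ) * (0 + signSum ω x) ^ 2))]
      calc _ ≤ (2 ^ n * exp (1 / 2)) ^ r * exp (-(3 / 2 * r)) := by gcongr
        _ = _ := by
          rw [mul_pow, ← exp_nat_mul, mul_assoc, ← exp_add]; congr 2; ring

lemma card_sum_sq_lt_le {n r : ℕ} (x : Fin n → ℝ) :
    ((Finset.univ.filter fun ε : Fin r → Fin n → Bool =>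
      ∑ l, signSum (ε l) x ^ 2 < r * (∑ k, x k ^ 2) / 4).card : ℝ) ≤
      (2 ^ n) ^ r * exp (-(r / 12)) := by
  set σ := ∑ k, x k ^ 2 with hσ
  have hσ0 : 0 ≤ σ := Finset.sum_nonneg fun k _ => sq_nonneg (x k)
  rcases hσ0.eq_or_lt with h0 | h0
  · rw [Finset.filter_false_of_mem]
    · simp; positivity
    · intro ε _
      rw [← h0]; simp; exact Finset.sum_nonneg fun _ _ => sq_nonneg _
  · have key := sum_exp_neg_sq_signSum_le x h0
    rw [← hσ] at key
    refine (card_filter_le_sum_exp _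
      (fun ε => (∑ l, -(signSum (ε l) x ^ 2 / (3 * σ))) + r / 12) ?_).trans ?_
    · intro ε hε
      rw [Finset.sum_neg_distrib, ← Finset.sum_div]
      have : (∑ l, signSum (ε l) x ^ 2) / (3 * σ) ≤ (r * σ / 4) / (3 * σ) := by gcongr
      have e2 : (r * σ / 4) / (3 * σ) = r / 12 := by field_simp; ring
      linarith
    · simp only [exp_add, exp_sum]
      rw [← Finset.sum_mul, ← Fintype.sum_pow (fun ω => exp (-(signSum ω x ^ 2 / (3 * σ))))]
      calc _ ≤ (2 ^ n * exp (-(1 / 6))) ^ r * exp (r / 12) := by gcongr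
        _ = _ := by
          rw [mul_pow, ← exp_nat_mul, mul_assoc, ← exp_add]; congr 2; ring

/-- A Johnson–Lindenstrauss type statement for random sign matrices. -/
lemma exists_sign_matrix {n r : ℕ} {A B : Type*} [Fintype A] [Fintype B]
    (u : A → Fin n → ℝ) (v : B → Fin n → ℝ)
    (h : Fintype.card A * exp (-r) + Fintype.card B * exp (-(r / 12)) < 1) :
    ∃ ε : Fin r → Fin n → Bool,
      (∀ a, ∑ l, signSum (ε l) (u a) ^ 2 ≤ 6 * r * ∑ k, u a k ^ 2) ∧
      ∀ b, r * (∑ k, v b k ^ 2) / 4 ≤ ∑ l, signSum (ε l) (v b) ^ 2 := by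
  by_contra! hcon
  set SA := fun a => Finset.univ.filter fun ε : Fin r → Fin n → Bool =>
      6 * r * ∑ k, u a k ^ 2 < ∑ l, signSum (ε l) (u a) ^ 2
  set SB := fun b => Finset.univ.filter fun ε : Fin r → Fin n → Bool =>
      ∑ l, signSum (ε l) (v b) ^ 2 < r * (∑ k, v b k ^ 2) / 4
  have hcov : (Finset.univ : Finset (Fin r → Fin n → Bool)) ⊆
      Finset.univ.biUnion SA ∪ Finset.univ.biUnion SB := by
    intro ε _
    rw [Finset.mem_union, Finset.mem_biUnion, Finset.mem_biUnion]
    by_cases hA : ∀ a, ∑ l, signSum (ε l) (u a) ^ 2 ≤ 6 * r * ∑ k, u a k ^ 2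
    · obtain ⟨b, hb⟩ := hcon ε hA
      exact Or.inr ⟨b, Finset.mem_univ _, by simpa [SB] using hb⟩
    · push Not at hA
      obtain ⟨a, ha⟩ := hA
      exact Or.inl ⟨a, Finset.mem_univ _, by simpa [SA] using ha⟩
  have h1 := (Finset.card_le_card hcov).trans (Finset.card_union_le _ _)
  have h2 : (Fintype.card (Fin r → Fin n → Bool) : ℝ) ≤
      ∑ a, ((SA a).card : ℝ) + ∑ b, ((SB b).card : ℝ) := by
    rw [Finset.card_univ] at h1
    have := h1.trans (add_le_add Finset.card_biUnion_le Finset.card_biUnion_le)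
    exact_mod_cast this
  have h3 : (Fintype.card (Fin r → Fin n → Bool) : ℝ) = (2 ^ n) ^ r := by simp
  have h4 : ∑ a, ((SA a).card : ℝ) ≤ Fintype.card A * ((2 ^ n) ^ r * exp (-r)) := by
    refine (Finset.sum_le_sum fun a _ => card_sum_sq_gt_le (u a)).trans ?_
    simp
  have h5 : ∑ b, ((SB b).card : ℝ) ≤ Fintype.card B * ((2 ^ n) ^ r * exp (-(r / 12))) := by
    refine (Finset.sum_le_sum fun b _ => card_sum_sq_lt_le (v b)).trans ?_
    simp
  have h6 : (0 : ℝ) < (2 ^ n) ^ r := by positivity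
  nlinarith

/-! ### Maurey's empirical method and duality -/

/-- Maurey's empirical method: a convex combination is approximated by averages. -/
lemma exists_empirical_approx {E J : Type*} [NormedAddCommGroup E] [InnerProductSpace ℂ E]
    [Fintype J] (w : J → ℝ) (hw : ∀ j, 0 ≤ w j) (hw1 : ∑ j, w j = 1) (T : J → E) (B : ℝ)
    (hB : ∀ j, ‖T j‖ ^ 2 ≤ B) (s : ℕ) :
    ∃ σ : Fin s → J, ‖(s : ℂ) • (∑ j, (w j : ℂ) • T j) - ∑ r, T (σ r)‖ ^ 2 ≤ s * B := by
  set z := ∑ j, (w j : ℂ) • T j with hz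
  have step : ∀ e : E, ∃ j, ‖e + z - T j‖ ^ 2 ≤ ‖e‖ ^ 2 + B := by
    intro e
    by_contra! hcon
    have h1 : ∑ j, w j * ‖e + z - T j‖ ^ 2 ≤ ‖e‖ ^ 2 + B := by
      have e1 : ∑ j, w j * ‖e + z - T j‖ ^ 2 =
          ‖e + z‖ ^ 2 - 2 * RCLike.re (inner ℂ (e + z) z) + ∑ j, w j * ‖T j‖ ^ 2 := by
        have : ∀ j, w j * ‖e + z - T j‖ ^ 2 = w j * ‖e + z‖ ^ 2 -
            2 * RCLike.re (inner ℂ (e + z) ((w j : ℂ) • T j)) + w j * ‖T j‖ ^ 2 := by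
          intro j
          rw [norm_sub_sq (𝕜 := ℂ), inner_smul_right]
          simp only [RCLike.re_to_complex, Complex.re_ofReal_mul]
          ring
        simp only [this, Finset.sum_add_distrib, Finset.sum_sub_distrib]
        rw [← Finset.sum_mul, hw1, one_mul, ← Finset.mul_sum, ← map_sum, ← inner_sum]
      have e2 : ‖e‖ ^ 2 = ‖e + z‖ ^ 2 - 2 * RCLike.re (inner ℂ (e + z) z) + ‖z‖ ^ 2 := by
        rw [← norm_sub_sq (𝕜 := ℂ), add_sub_cancel_right]
      have e3 : ∑ j, w j * ‖T j‖ ^ 2 ≤ B := by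
        calc _ ≤ ∑ j, w j * B := Finset.sum_le_sum fun j _ =>
              mul_le_mul_of_nonneg_left (hB j) (hw j)
          _ = B := by rw [← Finset.sum_mul, hw1, one_mul]
      nlinarith [sq_nonneg ‖z‖]
    have h2 : ∑ j, w j * (‖e + z - T j‖ ^ 2 - (‖e‖ ^ 2 + B)) ≤ 0 := by
      simp only [mul_sub, Finset.sum_sub_distrib, ← Finset.sum_mul, hw1]
      linarith
    have h3 : ∀ j ∈ Finset.univ, 0 ≤ w j * (‖e + z - T j‖ ^ 2 - (‖e‖ ^ 2 + B)) := fun j _ =>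
      mul_nonneg (hw j) (by linarith [hcon j])
    have h4 := (Finset.sum_eq_zero_iff_of_nonneg h3).1 (le_antisymm h2 (Finset.sum_nonneg h3))
    have h5 : ∀ j, w j = 0 := fun j => by
      rcases mul_eq_zero.1 (h4 j (Finset.mem_univ j)) with h | h
      · exact h
      · linarith [hcon j]
    simp [h5] at hw1
  induction s with
  | zero => exact ⟨Fin.elim0, by simp⟩
  | succ s ih =>
    obtain ⟨σ, hσ⟩ := ih
    obtain ⟨j, hj⟩ := step ((s : ℂ) • z - ∑ r, T (σ r))
    refine ⟨Fin.snoc σ j, ?_⟩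
    rw [Fin.sum_univ_castSucc]
    simp only [Fin.snoc_castSucc, Fin.snoc_last]
    have : ((s + 1 : ℕ) : ℂ) • z - (∑ r, T (σ r) + T j) =
        (s : ℂ) • z - ∑ r, T (σ r) + z - T j := by
      push_cast; rw [add_smul, one_smul]; abel
    rw [this]
    push_cast
    linarith

/-- Duality for best approximation from a subspace of `ℓ_∞`. -/
lemma exists_approx_of_annihilator {ι : Type*} [Fintype ι] (W : Submodule ℂ (ι → ℂ))
    (x : ι → ℂ) (D : ℝ)
    (h : ∀ y : ι → ℂ, ∑ i, ‖y i‖ ≤ 1 → (∀ w ∈ W, ∑ i, y i * w i = 0) → ‖∑ i, y i * x i‖ ≤ D) :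
    ∃ w ∈ W, ∀ i, ‖x i - w i‖ ≤ D := by
  have hcl : IsClosed (W : Set (ι → ℂ)) := W.closed_of_finiteDimensional
  obtain ⟨w, hw, hdist⟩ := hcl.exists_infDist_eq_dist ⟨0, W.zero_mem⟩ x
  refine ⟨w, hw, fun i => ?_⟩
  refine (norm_le_pi_norm (x - w) i).trans ?_
  rw [← dist_eq_norm, ← hdist]
  obtain ⟨g, hg1, hg2⟩ := exists_dual_vector'' ℂ (W.mkQ x)
  have hnorm : ‖W.mkQ x‖ = Metric.infDist x W :=
    QuotientAddGroup.norm_mk (S := W.toAddSubgroup) x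
  set y : ι → ℂ := fun i => g (W.mkQ (Pi.single i 1)) with hy
  have hgx : ∀ v : ι → ℂ, g (W.mkQ v) = ∑ i, y i * v i := by
    intro v
    conv_lhs => rw [pi_eq_sum_univ' v]
    simp only [map_sum, map_smul, smul_eq_mul]
    exact Finset.sum_congr rfl fun i _ => mul_comm _ _
  have hle : ∀ v : ι → ℂ, ‖g (W.mkQ v)‖ ≤ ‖v‖ := by
    intro v
    calc ‖g (W.mkQ v)‖ ≤ ‖g‖ * ‖W.mkQ v‖ := g.le_opNorm _
      _ ≤ 1 * ‖v‖ := by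
        gcongr
        exact Submodule.Quotient.norm_mk_le W v
      _ = ‖v‖ := one_mul _
  have hy1 : ∑ i, ‖y i‖ ≤ 1 := by
    have h1 := hle (fun i => if y i = 0 then 0 else conj (y i) / ‖y i‖)
    rw [hgx] at h1
    have e1 : ∑ i, y i * (if y i = 0 then 0 else conj (y i) / ‖y i‖) = ((∑ i, ‖y i‖ : ℝ) : ℂ) := by
      push_cast
      refine Finset.sum_congr rfl fun i _ => ?_
      split_ifs with h0
      · simp [h0]
      · have : (‖y i‖ : ℂ) ≠ 0 := by simpa using h0
        rw [mul_div_assoc', Complex.mul_conj, Complex.normSq_eq_norm_sq]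
        field_simp
        push_cast; ring
    rw [e1, Complex.norm_real, norm_of_nonneg (Finset.sum_nonneg fun _ _ => norm_nonneg _)] at h1
    refine h1.trans ((pi_norm_le_iff_of_nonneg zero_le_one).2 fun i => ?_)
    split_ifs with h0
    · simp
    · have : ‖y i‖ ≠ 0 := by simpa using h0
      simp [this]
  have h3 := h y hy1 (fun w hw => by
    rw [← hgx, Submodule.mkQ_apply, (Submodule.Quotient.mk_eq_zero W).2 hw, map_zero])
  rw [← hgx, hg2] at h3
  rw [← hnorm]
  simpa using h3

/-! ### Kolmogorov widths of Euclidean balls in the uniform norm -/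

/-- The signed sum of a complex vector. -/
def signSumC {n : ℕ} (ε : Fin n → Bool) : (Fin n → ℂ) →ₗ[ℂ] ℂ where
  toFun z := ∑ k, (boolSign (ε k) : ℂ) * z k
  map_add' x y := by simp [mul_add, Finset.sum_add_distrib]
  map_smul' c x := by
    simp only [Pi.smul_apply, smul_eq_mul, RingHom.id_apply, Finset.mul_sum]
    exact Finset.sum_congr rfl fun _ _ => by ring

lemma norm_signSumC_sq {n : ℕ} (ε : Fin n → Bool) (z : Fin n → ℂ) :
    ‖signSumC ε z‖ ^ 2 =
      signSum ε (fun k => (z k).re) ^ 2 + signSum ε (fun k => (z k).im) ^ 2 := by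
  rw [← Complex.normSq_eq_norm_sq, Complex.normSq_apply]
  simp only [signSumC, signSum, LinearMap.coe_mk, AddHom.coe_mk, Complex.re_sum, Complex.im_sum,
    Complex.re_ofReal_mul, Complex.im_ofReal_mul]
  ring

/-- The linear map `z ↦ (z, r^{-1/2} Γ z)` for a sign matrix `Γ`. -/
def signGraph {n r : ℕ} (ε : Fin r → Fin n → Bool) :
    (Fin n → ℂ) →ₗ[ℂ] EuclideanSpace ℂ (Fin n ⊕ Fin r) :=
  (WithLp.linearEquiv 2 ℂ (Fin n ⊕ Fin r → ℂ)).symm.toLinearMap ∘ₗ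
    LinearMap.pi (Sum.elim (fun k => LinearMap.proj k)
      (fun l => ((√r)⁻¹ : ℂ) • signSumC (ε l)))

lemma norm_signGraph_sq {n r : ℕ} (ε : Fin r → Fin n → Bool) (z : Fin n → ℂ) :
    ‖signGraph ε z‖ ^ 2 = ∑ k, ‖z k‖ ^ 2 + (∑ l, ‖signSumC (ε l) z‖ ^ 2) / r := by
  rw [EuclideanSpace.norm_sq_eq, Fintype.sum_sum_type]
  congr 1
  rw [Finset.sum_div]
  refine Finset.sum_congr rfl fun l _ => ?_
  have : signGraph ε z (Sum.inr l) = ((√r)⁻¹ : ℂ) * signSumC (ε l) z := rfl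
  rw [this, norm_mul, mul_pow, norm_inv, Complex.norm_real, inv_pow,
    norm_of_nonneg (sqrt_nonneg _), sq_sqrt (by positivity)]
  ring

lemma norm_sq_le_two_mul_add {a b : ℂ} : ‖a + b‖ ^ 2 ≤ 2 * ‖a‖ ^ 2 + 2 * ‖b‖ ^ 2 := by
  have := norm_add_le a b
  nlinarith [sq_nonneg (‖a‖ - ‖b‖), norm_nonneg (a + b), norm_nonneg a, norm_nonneg b]

/-- The real or the imaginary part of a complex vector, whichever is larger. -/
def mainPart {n : ℕ} (z : Fin n → ℂ) : Fin n → ℝ :=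
  if ∑ k, (z k).im ^ 2 ≤ ∑ k, (z k).re ^ 2 then fun k => (z k).re else fun k => (z k).im

lemma norm_sq_le_mainPart {n : ℕ} (z : Fin n → ℂ) :
    ∑ k, ‖z k‖ ^ 2 ≤ 2 * ∑ k, mainPart z k ^ 2 := by
  have : ∑ k, ‖z k‖ ^ 2 = ∑ k, (z k).re ^ 2 + ∑ k, (z k).im ^ 2 := by
    rw [← Finset.sum_add_distrib]
    refine Finset.sum_congr rfl fun k _ => ?_
    rw [← Complex.normSq_eq_norm_sq, Complex.normSq_apply]; ring
  rw [this, mainPart]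
  split_ifs with h <;> linarith

lemma signSum_mainPart_sq_le {n : ℕ} (ε : Fin n → Bool) (z : Fin n → ℂ) :
    signSum ε (mainPart z) ^ 2 ≤ ‖signSumC ε z‖ ^ 2 := by
  rw [norm_signSumC_sq, mainPart]
  split_ifs with h
  · nlinarith [sq_nonneg (signSum ε fun k => (z k).im)]
  · nlinarith [sq_nonneg (signSum ε fun k => (z k).re)]

/-- The vectors `0` and `i^c aᵢ`, `c = 0,1,2,3`, spanning the absolutely convex hull of the
rows of a matrix. -/
def hullAtom {ι : Type*} {n : ℕ} (a : ι → Fin n → ℂ) : Option (ι × Fin 4) → Fin n → ℂ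
  | none => 0
  | some (i, c) => (Complex.I ^ (c : ℕ)) • a i

lemma exists_hull_weights {ι : Type*} [Fintype ι] {n : ℕ} (a : ι → Fin n → ℂ) (y : ι → ℂ)
    (hy : ∑ i, ‖y i‖ ≤ 1) :
    ∃ w : Option (ι × Fin 4) → ℝ, (∀ j, 0 ≤ w j) ∧ ∑ j, w j = 1 ∧
      ∑ j, (w j : ℂ) • hullAtom a j = (1 / 2 : ℂ) • ∑ i, y i • a i := by
  set v : ι × Fin 4 → ℝ := fun q =>
    ![max (y q.1).re 0, max (y q.1).im 0, max (-(y q.1).re) 0, max (-(y q.1).im) 0] q.2 / 2 with hv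
  have hv0 : ∀ q, 0 ≤ v q := by
    rintro ⟨i, c⟩
    fin_cases c <;> simp [hv] <;> positivity
  have hmax : ∀ t : ℝ, max t 0 + max (-t) 0 = |t| := fun t => by
    rcases le_total 0 t with h | h
    · rw [max_eq_left h, max_eq_right (by linarith), abs_of_nonneg h, add_zero]
    · rw [max_eq_right h, max_eq_left (by linarith), abs_of_nonpos h, zero_add]
  have hmax' : ∀ t : ℝ, max t 0 - max (-t) 0 = t := fun t => by
    rcases le_total 0 t with h | h
    · rw [max_eq_left h, max_eq_right (by linarith), sub_zero]
    · rw [max_eq_right h, max_eq_left (by linarith)]; ring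
  have hv1 : ∑ q, v q ≤ 1 := by
    refine le_trans ?_ hy
    rw [Fintype.sum_prod_type]
    refine Finset.sum_le_sum fun i _ => ?_
    simp only [hv, Fin.sum_univ_four]
    simp
    have h1 := hmax (y i).re
    have h2 := hmax (y i).im
    have h3 := Complex.abs_re_le_norm (y i)
    have h4 := Complex.abs_im_le_norm (y i)
    linarith
  refine ⟨fun j => j.elim (1 - ∑ q, v q) v, ?_, ?_, ?_⟩
  · rintro (_ | q)
    · simpa using hv1
    · exact hv0 q
  · rw [Fintype.sum_option]; simp
  · rw [Fintype.sum_option, Finset.smul_sum]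
    simp only [hullAtom, smul_zero, zero_add, Option.elim]
    rw [Fintype.sum_prod_type]
    refine Finset.sum_congr rfl fun i _ => ?_
    rw [Fin.sum_univ_four]
    simp only [smul_smul, ← add_smul]
    congr 1
    have e1 : Complex.I ^ 3 = -Complex.I := by rw [pow_succ, Complex.I_sq]; ring
    simp [hv, e1]
    conv_rhs => rw [← Complex.re_add_im (y i)]
    conv_rhs => rw [← hmax' (y i).re, ← hmax' (y i).im]
    push_cast
    ring

lemma norm_hullAtom_le {ι : Type*} {n : ℕ} (a : ι → Fin n → ℂ) (ha : ∀ i k, ‖a i k‖ ≤ 1)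
    (j : Option (ι × Fin 4)) (k : Fin n) : ‖hullAtom a j k‖ ≤ 1 := by
  rcases j with _ | ⟨i, c⟩
  · simp [hullAtom]
  · simpa [hullAtom] using ha i k

lemma sum_norm_signSumC_hullAtom_le {ι : Type*} {n r : ℕ} (a : ι → Fin n → ℂ)
    (ε : Fin r → Fin n → Bool) {D : ℝ} (hD : 0 ≤ D)
    (h : ∀ i, ∑ l, ‖signSumC (ε l) (a i)‖ ^ 2 ≤ D) (j : Option (ι × Fin 4)) :
    ∑ l, ‖signSumC (ε l) (hullAtom a j)‖ ^ 2 ≤ D := by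
  rcases j with _ | ⟨i, c⟩
  · simpa [hullAtom] using hD
  · simpa [hullAtom] using h i

/-- A random kernel of codimension `r` has small intersection with the absolutely convex hull of
the rows of a matrix with entries bounded by `1`. -/
lemma exists_sign_matrix_small_section {ι : Type*} [Fintype ι] {n r s : ℕ} (hr : 0 < r)
    (hs : 0 < s) (a : ι → Fin n → ℂ) (ha : ∀ i k, ‖a i k‖ ≤ 1)
    (hcard : (Fintype.card (ι × Bool) : ℝ) * exp (-r) +
      (Fintype.card (Fin s → Option (ι × Fin 4)) : ℝ) * exp (-(r / 12)) < 1) :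
    ∃ ε : Fin r → Fin n → Bool, ∀ y : ι → ℂ, ∑ i, ‖y i‖ ≤ 1 →
      (∀ l, signSumC (ε l) (∑ i, y i • a i) = 0) →
      ∑ k, ‖(∑ i, y i • a i) k‖ ^ 2 ≤ 936 * n / s := by
  obtain ⟨ε, hup, hlow⟩ := exists_sign_matrix
    (fun q : ι × Bool => fun k => if q.2 then (a q.1 k).re else (a q.1 k).im)
    (fun σ : Fin s → Option (ι × Fin 4) => mainPart (∑ q, hullAtom a (σ q))) hcard
  refine ⟨ε, fun y hy hz => ?_⟩
  set z := ∑ i, y i • a i with hzdef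
  have hr' : (0 : ℝ) < r := by exact_mod_cast hr
  have hs' : (0 : ℝ) < s := by exact_mod_cast hs
  have hrow : ∀ i, ∑ l, ‖signSumC (ε l) (a i)‖ ^ 2 ≤ 12 * r * n := by
    intro i
    have h1 := hup (i, true)
    have h2 := hup (i, false)
    simp only [if_true, Bool.false_eq_true, if_false] at h1 h2
    have h3 : ∀ k, (a i k).re ^ 2 ≤ 1 := fun k => by
      have := (Complex.abs_re_le_norm (a i k)).trans (ha i k)
      exact (sq_le_one_iff_abs_le_one _).2 this
    have h4 : ∀ k, (a i k).im ^ 2 ≤ 1 := fun k => by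
      have := (Complex.abs_im_le_norm (a i k)).trans (ha i k)
      exact (sq_le_one_iff_abs_le_one _).2 this
    have h5 : ∑ k, (a i k).re ^ 2 ≤ n := by
      refine (Finset.sum_le_sum fun k _ => h3 k).trans ?_
      simp
    have h6 : ∑ k, (a i k).im ^ 2 ≤ n := by
      refine (Finset.sum_le_sum fun k _ => h4 k).trans ?_
      simp
    simp only [norm_signSumC_sq, Finset.sum_add_distrib]
    have h7 := mul_le_mul_of_nonneg_left h5 (by positivity : (0 : ℝ) ≤ 6 * r)
    have h8 := mul_le_mul_of_nonneg_left h6 (by positivity : (0 : ℝ) ≤ 6 * r)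
    linarith
  obtain ⟨w, hw0, hw1, hwz⟩ := exists_hull_weights a y hy
  obtain ⟨σ, hσ⟩ := exists_empirical_approx w hw0 hw1 (fun j => signGraph ε (hullAtom a j))
    (13 * n) (fun j => by
      rw [norm_signGraph_sq]
      have h1 : ∑ k, ‖hullAtom a j k‖ ^ 2 ≤ n := by
        refine (Finset.sum_le_sum fun k _ => pow_le_one₀ (norm_nonneg _)
          (norm_hullAtom_le a ha j k)).trans ?_
        simp
      have h2 := sum_norm_signSumC_hullAtom_le a ε (by positivity) hrow j
      have h3 : (∑ l, ‖signSumC (ε l) (hullAtom a j)‖ ^ 2) / r ≤ 12 * n := by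
        rw [div_le_iff₀ hr']; linarith
      linarith) s
  set u := ∑ q, hullAtom a (σ q) with hu
  have hσ2 : ‖signGraph ε (((s : ℂ) / 2) • z - u)‖ ^ 2 ≤ s * (13 * n) := by
    have heq : signGraph ε (((s : ℂ) / 2) • z - u) =
        (s : ℂ) • (∑ j, (w j : ℂ) • signGraph ε (hullAtom a j)) -
          ∑ q, signGraph ε (hullAtom a (σ q)) := by
      have hT : ∑ j, (w j : ℂ) • signGraph ε (hullAtom a j) =
          signGraph ε (∑ j, (w j : ℂ) • hullAtom a j) := by
        rw [map_sum]; simp only [map_smul]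
      have hU : ∑ q, signGraph ε (hullAtom a (σ q)) = signGraph ε u := by rw [hu, map_sum]
      rw [map_sub, map_smul, hT, hU, hwz, map_smul, smul_smul, div_eq_mul_one_div]
    rw [heq]
    exact hσ
  rw [norm_signGraph_sq] at hσ2
  have hzero : ∀ l, signSumC (ε l) (((s : ℂ) / 2) • z - u) = - signSumC (ε l) u := by
    intro l
    rw [map_sub, map_smul, hz l, smul_zero, zero_sub]
  simp only [hzero, norm_neg] at hσ2
  set P := ∑ l, ‖signSumC (ε l) u‖ ^ 2 with hP
  have hP0 : 0 ≤ P / r := div_nonneg (Finset.sum_nonneg fun _ _ => sq_nonneg _) hr'.le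
  have hres0 : 0 ≤ ∑ k, ‖(((s : ℂ) / 2) • z - u) k‖ ^ 2 :=
    Finset.sum_nonneg fun _ _ => sq_nonneg _
  have hu2 : ∑ k, ‖u k‖ ^ 2 ≤ 8 * (P / r) := by
    have h1 := hlow σ
    rw [← hu] at h1
    have h2 : ∑ l, signSum (ε l) (mainPart u) ^ 2 ≤ P :=
      Finset.sum_le_sum fun l _ => signSum_mainPart_sq_le (ε l) u
    have h3 := norm_sq_le_mainPart u
    have h4 : (∑ k, mainPart u k ^ 2) / 4 ≤ P / r := by
      rw [le_div_iff₀ hr']; linarith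
    linarith
  have hfin : ∑ k, ‖(((s : ℂ) / 2) • z) k‖ ^ 2 ≤ 234 * n * s := by
    have h1 : ∑ k, ‖(((s : ℂ) / 2) • z) k‖ ^ 2 ≤
        2 * ∑ k, ‖(((s : ℂ) / 2) • z - u) k‖ ^ 2 + 2 * ∑ k, ‖u k‖ ^ 2 := by
      rw [Finset.mul_sum, Finset.mul_sum, ← Finset.sum_add_distrib]
      refine Finset.sum_le_sum fun k _ => ?_
      have := norm_sq_le_two_mul_add (a := (((s : ℂ) / 2) • z - u) k) (b := u k)
      simpa using this
    linarith
  have hscale : ∑ k, ‖(((s : ℂ) / 2) • z) k‖ ^ 2 = s ^ 2 / 4 * ∑ k, ‖z k‖ ^ 2 := by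
    rw [Finset.mul_sum]
    refine Finset.sum_congr rfl fun k _ => ?_
    simp [mul_pow, div_pow]
    norm_num
  rw [hscale] at hfin
  rw [le_div_iff₀ hs']
  have : (s : ℝ) * (∑ k, ‖z k‖ ^ 2 * s) ≤ s * (936 * n) := by
    rw [← Finset.sum_mul]; nlinarith
  rw [← Finset.sum_mul] at this
  exact le_of_mul_le_mul_left this hs'

lemma card_bound_aux {M r s : ℕ} {Lg : ℝ} (hL : 1 ≤ Lg) (hM : (M : ℝ) ≤ exp Lg) (hs : 1 ≤ s)
    (hr : 72 * Lg * s ≤ r) :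
    ((M * 2 : ℕ) : ℝ) * exp (-r) + (((M * 4 + 1) ^ s : ℕ) : ℝ) * exp (-(r / 12)) < 1 := by
  have e1 : (2 : ℝ) < exp 1 := by have := exp_one_gt_d9; linarith
  have hs1 : (1 : ℝ) ≤ s := by exact_mod_cast hs
  have hLs : Lg ≤ Lg * s := le_mul_of_one_le_right (by linarith) hs1
  have e1L : (2 : ℝ) < exp Lg := e1.trans_le (exp_le_exp.2 hL)
  have hhalf : exp (-1) < 1 / 2 := by
    rw [exp_neg, one_div]; exact inv_strictAnti₀ (by norm_num) e1
  have h1 : ((M * 2 : ℕ) : ℝ) * exp (-r) ≤ exp (-1) := by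
    calc ((M * 2 : ℕ) : ℝ) * exp (-r) ≤ (exp Lg * exp Lg) * exp (-r) := by
          push_cast; gcongr
      _ = exp (Lg + Lg - r) := by rw [← exp_add, ← exp_add]; ring_nf
      _ ≤ _ := exp_le_exp.2 (by linarith)
  have h2 : (((M * 4 + 1) ^ s : ℕ) : ℝ) * exp (-(r / 12)) ≤ exp (-1) := by
    have h3 : ((M * 4 + 1 : ℕ) : ℝ) ≤ exp (4 * Lg) := by
      have h4 : exp (4 * Lg) = exp Lg * (exp Lg * exp Lg * exp Lg) := by
        simp only [← exp_add]; ring_nf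
      rw [h4]
      push_cast
      have h8 : 8 ≤ exp Lg * exp Lg * exp Lg := by nlinarith [mul_pos (exp_pos Lg) (exp_pos Lg)]
      nlinarith [exp_pos Lg]
    calc (((M * 4 + 1) ^ s : ℕ) : ℝ) * exp (-(r / 12)) ≤ exp (4 * Lg) ^ s * exp (-(r / 12)) := by
          push_cast at h3 ⊢; gcongr
      _ = exp (s * (4 * Lg) - r / 12) := by rw [← exp_nat_mul, ← exp_add]; ring_nf
      _ ≤ _ := exp_le_exp.2 (by nlinarith)
  linarith

/-- Kolmogorov widths of the image of the Euclidean ball under a matrix with entries bounded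
by `1`, in the uniform norm. -/
lemma exists_subspace_approx_sup {ι : Type*} [Fintype ι] {n m : ℕ} (hm : 1 ≤ m)
    (a : ι → Fin n → ℂ) (ha : ∀ i k, ‖a i k‖ ≤ 1) {Lg : ℝ} (hL : 1 ≤ Lg)
    (hM : (Fintype.card ι : ℝ) ≤ exp Lg) :
    ∃ V : Submodule ℂ (Fin n → ℂ), Module.finrank ℂ V < m ∧ ∀ h : Fin n → ℂ, ∃ b ∈ V,
      ∀ i, ‖∑ k, a i k * (h k - b k)‖ ≤
        sqrt (300000 * n * Lg / m) * sqrt (∑ k, ‖h k‖ ^ 2) := by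
  have hm0 : (0 : ℝ) < m := by exact_mod_cast hm
  have hCS : ∀ (z h : Fin n → ℂ) (D : ℝ), ∑ k, ‖z k‖ ^ 2 ≤ D →
      ‖∑ k, z k * h k‖ ≤ sqrt D * sqrt (∑ k, ‖h k‖ ^ 2) := by
    intro z h D hD
    calc ‖∑ k, z k * h k‖ ≤ ∑ k, ‖z k‖ * ‖h k‖ := by
          refine (norm_sum_le _ _).trans_eq ?_
          simp only [norm_mul]
      _ ≤ sqrt (∑ k, ‖z k‖ ^ 2) * sqrt (∑ k, ‖h k‖ ^ 2) :=
          sum_mul_le_sqrt_mul_sqrt _ _ _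
      _ ≤ _ := by gcongr
  by_cases hsmall : ((m - 1 : ℕ) : ℝ) < 72 * Lg
  · refine ⟨⊥, by rw [finrank_bot]; omega, fun h => ⟨0, by simp, fun i => ?_⟩⟩
    simp only [Pi.zero_apply, sub_zero]
    refine hCS (a i) h _ ?_
    have h1 : ∑ k, ‖a i k‖ ^ 2 ≤ n := by
      refine (Finset.sum_le_sum fun k _ => pow_le_one₀ (norm_nonneg _) (ha i k)).trans ?_
      simp
    refine h1.trans ?_
    rw [le_div_iff₀ hm0]
    have h2 : (m : ℝ) ≤ 73 * Lg := by
      rw [Nat.cast_sub hm] at hsmall; push_cast at hsmall; linarith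
    have : (0 : ℝ) ≤ n := by positivity
    nlinarith
  push Not at hsmall
  set r := m - 1 with hr
  have hrm : (m : ℝ) = r + 1 := by rw [hr, Nat.cast_sub hm]; push_cast; ring
  have hr0 : 0 < r := by
    have : (0 : ℝ) < r := by linarith
    exact_mod_cast this
  obtain ⟨s, hs⟩ : ∃ s : ℕ, s = ⌊(r : ℝ) / (72 * Lg)⌋₊ := ⟨_, rfl⟩
  have hs1 : 1 ≤ s := by
    rw [hs, Nat.one_le_floor_iff, one_le_div (by linarith)]; exact hsmall
  have hs2 : 72 * Lg * s ≤ r := by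
    have := Nat.floor_le (a := (r : ℝ) / (72 * Lg)) (by positivity)
    rw [← hs, le_div_iff₀ (by linarith)] at this
    linarith
  have hs3 : (m : ℝ) ≤ 288 * Lg * s := by
    have := Nat.lt_floor_add_one ((r : ℝ) / (72 * Lg))
    rw [← hs, div_lt_iff₀ (by linarith)] at this
    have hs1' : (1 : ℝ) ≤ s := by exact_mod_cast hs1
    have h5 := mul_le_mul hL hs1' (by norm_num) (by linarith)
    nlinarith
  have hcard : (Fintype.card (ι × Bool) : ℝ) * exp (-r) +
      (Fintype.card (Fin s → Option (ι × Fin 4)) : ℝ) * exp (-(r / 12)) < 1 := by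
    have := card_bound_aux hL hM hs1 hs2
    simpa [Fintype.card_prod, Fintype.card_option] using this
  obtain ⟨ε, hε⟩ := exists_sign_matrix_small_section hr0 hs1 a ha hcard
  set row : Fin r → Fin n → ℂ := fun l k => (boolSign (ε l k) : ℂ) with hrow
  refine ⟨Submodule.span ℂ (Set.range row), ?_, fun h => ?_⟩
  · have := finrank_range_le_card (R := ℂ) row
    rw [Fintype.card_fin] at this
    have h2 : Module.finrank ℂ (Submodule.span ℂ (Set.range row)) ≤ r := this
    omega
  set A : (Fin n → ℂ) →ₗ[ℂ] (ι → ℂ) := (Matrix.of a).mulVecLin with hA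
  have hAap : ∀ x i, A x i = ∑ k, a i k * x k := by
    intro x i; simp [hA, Matrix.mulVec, dotProduct]
  have hdual := exists_approx_of_annihilator
    ((Submodule.span ℂ (Set.range row)).map A) (A h)
    (sqrt (300000 * n * Lg / m) * sqrt (∑ k, ‖h k‖ ^ 2)) ?_
  · obtain ⟨w, hw, hwi⟩ := hdual
    obtain ⟨b, hb, rfl⟩ := hw
    refine ⟨b, hb, fun i => ?_⟩
    have := hwi i
    rw [hAap, hAap, ← Finset.sum_sub_distrib] at this
    simpa only [mul_sub] using this
  intro y hy hann
  have hsw : ∀ x, ∑ i, y i * A x i = ∑ k, (∑ i, y i • a i) k * x k := by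
    intro x
    simp only [hAap, Finset.sum_apply, Pi.smul_apply, smul_eq_mul, Finset.mul_sum,
      Finset.sum_mul]
    rw [Finset.sum_comm]
    exact Finset.sum_congr rfl fun k _ => Finset.sum_congr rfl fun i _ => by ring
  rw [hsw]
  refine hCS _ _ _ ((hε y hy fun l => ?_).trans ?_)
  · have := hann (A (row l)) (Submodule.mem_map_of_mem (Submodule.subset_span ⟨l, rfl⟩))
    rw [hsw] at this
    rw [← this]
    simp only [signSumC, LinearMap.coe_mk, AddHom.coe_mk, hrow]
    exact Finset.sum_congr rfl fun k _ => mul_comm _ _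
  · have hs0 : (0 : ℝ) < s := by exact_mod_cast hs1
    rw [div_le_div_iff₀ hs0 hm0]
    have : (0 : ℝ) ≤ n := by positivity
    nlinarith [mul_le_mul_of_nonneg_left hs3 this, mul_nonneg this (mul_nonneg (by linarith : (0:ℝ) ≤ Lg) hs0.le)]

/-! ### Fourier analysis on the torus -/

lemma trigChar_apply {d : ℕ} (k : Fin d → ℤ) (x : Torus d) :
    trigChar k x = ∏ j, fourier (k j) (x j) := rfl

lemma norm_trigChar {d : ℕ} (k : Fin d → ℤ) (x : Torus d) : ‖trigChar k x‖ = 1 := by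
  rw [trigChar_apply, norm_prod]
  exact Finset.prod_eq_one fun j _ => Circle.norm_coe _

lemma trigChar_add {d : ℕ} (k l : Fin d → ℤ) (x : Torus d) :
    trigChar (k + l) x = trigChar k x * trigChar l x := by
  simp only [trigChar_apply, Pi.add_apply, fourier_add, Finset.prod_mul_distrib]

lemma trigChar_neg {d : ℕ} (k : Fin d → ℤ) (x : Torus d) :
    trigChar (-k) x = conj (trigChar k x) := by
  simp only [trigChar_apply, Pi.neg_apply, fourier_neg, map_prod]

lemma trigChar_sub_arg {d : ℕ} (k : Fin d → ℤ) (x y : Torus d) :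
    trigChar k (x - y) = trigChar k x * conj (trigChar k y) := by
  simp only [trigChar_apply, Pi.sub_apply, map_prod, ← Finset.prod_mul_distrib]
  refine Finset.prod_congr rfl fun j _ => ?_
  rw [← fourier_neg]
  simp only [fourier_apply, sub_eq_add_neg, smul_add, smul_neg, neg_smul, AddCircle.toCircle_add,
    Circle.coe_mul]

lemma integral_fourier (n : ℤ) :
    ∫ x : AddCircle (2 * π), fourier n x = if n = 0 then ((2 * π : ℝ) : ℂ) else 0 := by
  split_ifs with h
  · subst h
    simp [measureReal_def, AddCircle.measure_univ, pi_nonneg]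
  · have h1 : ∀ x : AddCircle (2 * π), fourier n (x + ((2 * π / 2 / n : ℝ) : AddCircle (2 * π))) =
        - fourier n x := fun x => fourier_add_half_inv_index h (by positivity) x
    have h2 := integral_add_right_eq_self (μ := (volume : Measure (AddCircle (2 * π))))
      (fun x => (fourier n x : ℂ)) ((2 * π / 2 / n : ℝ) : AddCircle (2 * π))
    simp only [h1, integral_neg] at h2
    exact self_eq_neg.1 h2.symm

lemma integral_trigChar {d : ℕ} (k : Fin d → ℤ) :
    ∫ x : Torus d, trigChar k x = if k = 0 then (((2 * π) ^ d : ℝ) : ℂ) else 0 := by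
  simp only [trigChar_apply]
  rw [integral_fintype_prod_volume_eq_prod (fun j x => (fourier (k j) x : ℂ))]
  simp only [integral_fourier]
  split_ifs with h
  · subst h; simp
  · obtain ⟨j, hj⟩ := Function.ne_iff.1 h
    exact Finset.prod_eq_zero (Finset.mem_univ j) (by simpa using hj)

lemma integral_conj_trigChar_mul {d : ℕ} (k l : Fin d → ℤ) :
    ∫ x : Torus d, conj (trigChar k x) * trigChar l x =
      if k = l then (((2 * π) ^ d : ℝ) : ℂ) else 0 := by
  simp only [← trigChar_neg, ← trigChar_add, integral_trigChar]
  congr 1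
  rw [neg_add_eq_zero]

lemma volume_torus (d : ℕ) : (volume : Measure (Torus d)).real Set.univ = (2 * π) ^ d := by
  rw [measureReal_def, volume_pi, Measure.pi_univ]
  simp [AddCircle.measure_univ, pi_nonneg]

instance {d : ℕ} : IsFiniteMeasure (volume : Measure (Torus d)) := inferInstance

lemma integrable_of_continuous {d : ℕ} {E : Type*} [NormedAddCommGroup E] {f : Torus d → E}
    (hf : Continuous f) : Integrable f :=
  hf.integrable_of_hasCompactSupport (HasCompactSupport.of_compactSpace _)

/-- The trigonometric polynomial with coefficients `c` and frequencies in `E`. -/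
def trigPoly {d : ℕ} (E : Finset (Fin d → ℤ)) (c : (Fin d → ℤ) → ℂ) : C(Torus d, ℂ) :=
  ∑ k ∈ E, c k • trigChar k

lemma trigPoly_apply {d : ℕ} (E : Finset (Fin d → ℤ)) (c : (Fin d → ℤ) → ℂ) (x : Torus d) :
    trigPoly E c x = ∑ k ∈ E, c k * trigChar k x := by
  simp [trigPoly, ContinuousMap.sum_apply]

lemma fCoeff_trigPoly {d : ℕ} (E : Finset (Fin d → ℤ)) (c : (Fin d → ℤ) → ℂ) (l : Fin d → ℤ) :
    fCoeff (trigPoly E c) l = if l ∈ E then c l else 0 := by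
  have h1 : ∀ x : Torus d, conj (trigChar l x) * trigPoly E c x =
      ∑ k ∈ E, c k * (conj (trigChar l x) * trigChar k x) := by
    intro x
    rw [trigPoly_apply, Finset.mul_sum]
    exact Finset.sum_congr rfl fun k _ => by ring
  have hpi : ((2 * π) ^ d : ℝ) ≠ 0 := by positivity
  simp only [fCoeff, h1]
  rw [integral_finsetSum _ fun k _ => integrable_of_continuous (by fun_prop)]
  simp only [integral_const_mul, integral_conj_trigChar_mul, mul_ite, mul_zero,
    Finset.sum_ite_eq]
  split_ifs with h
  · rw [Complex.real_smul, mul_comm (c l), ← mul_assoc, ← Complex.ofReal_mul, inv_mul_cancel₀ hpi]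
    simp
  · simp

lemma integral_norm_trigPoly_sq {d : ℕ} (E : Finset (Fin d → ℤ)) (c : (Fin d → ℤ) → ℂ) :
    ∫ x : Torus d, ‖trigPoly E c x‖ ^ 2 = (2 * π) ^ d * ∑ k ∈ E, ‖c k‖ ^ 2 := by
  have h1 : ∀ x : Torus d, ((‖trigPoly E c x‖ ^ 2 : ℝ) : ℂ) =
      ∑ k ∈ E, conj (c k) * (conj (trigChar k x) * trigPoly E c x) := by
    intro x
    rw [Complex.ofReal_pow, ← Complex.conj_mul']
    nth_rewrite 1 [trigPoly_apply]
    rw [map_sum, Finset.sum_mul]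
    exact Finset.sum_congr rfl fun k _ => by rw [map_mul]; ring
  have hpi : ((2 * π) ^ d : ℝ) ≠ 0 := by positivity
  have h2 : ∀ k ∈ E, ∫ x : Torus d, conj (trigChar k x) * trigPoly E c x =
      ((2 * π) ^ d : ℝ) * c k := by
    intro k hk
    have := fCoeff_trigPoly E c k
    rw [fCoeff, if_pos hk, inv_smul_eq_iff₀ hpi, Complex.real_smul] at this
    exact this
  have h3 : ((∫ x : Torus d, ‖trigPoly E c x‖ ^ 2 : ℝ) : ℂ) =
      (((2 * π) ^ d * ∑ k ∈ E, ‖c k‖ ^ 2 : ℝ) : ℂ) := by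
    rw [← integral_complex_ofReal]
    simp only [h1]
    rw [integral_finsetSum _ fun k _ => integrable_of_continuous (by fun_prop)]
    simp only [integral_const_mul]
    push_cast
    rw [Finset.mul_sum]
    refine Finset.sum_congr rfl fun k hk => ?_
    rw [h2 k hk, ← Complex.conj_mul']
    push_cast; ring
  exact_mod_cast h3

lemma integrable_conj_trigChar_mul {d : ℕ} {f : Torus d → ℂ} (hf : Integrable f)
    (k : Fin d → ℤ) : Integrable fun x => conj (trigChar k x) * f x :=
  hf.bdd_mul (c := 1) (by fun_prop)
    (Filter.Eventually.of_forall fun x => by simp [norm_trigChar])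

lemma fCoeff_add {d : ℕ} {f g : Torus d → ℂ} (hf : Integrable f) (hg : Integrable g)
    (k : Fin d → ℤ) : fCoeff (fun x => f x + g x) k = fCoeff f k + fCoeff g k := by
  simp only [fCoeff, mul_add]
  rw [integral_add (integrable_conj_trigChar_mul hf k) (integrable_conj_trigChar_mul hg k),
    smul_add]

lemma integral_conj_trigPoly_mul {d : ℕ} {f : Torus d → ℂ} (hf : Integrable f)
    (E : Finset (Fin d → ℤ)) (c : (Fin d → ℤ) → ℂ) :
    ∫ x, conj (trigPoly E c x) * f x = ((2 * π) ^ d : ℝ) * ∑ k ∈ E, conj (c k) * fCoeff f k := by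
  have h1 : ∀ x : Torus d, conj (trigPoly E c x) * f x =
      ∑ k ∈ E, conj (c k) * (conj (trigChar k x) * f x) := by
    intro x
    rw [trigPoly_apply, map_sum, Finset.sum_mul]
    exact Finset.sum_congr rfl fun k _ => by rw [map_mul]; ring
  have hpi : ((2 * π) ^ d : ℝ) ≠ 0 := by positivity
  simp only [h1]
  rw [integral_finsetSum _ fun k _ => (integrable_conj_trigChar_mul hf k).const_mul _,
    Finset.mul_sum]
  refine Finset.sum_congr rfl fun k _ => ?_
  rw [integral_const_mul, fCoeff, Complex.real_smul]
  push_cast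
  have : ((2 * (π : ℂ)) ^ d) ≠ 0 := by exact_mod_cast hpi
  field_simp

/-- Bessel's inequality. -/
lemma sum_norm_fCoeff_sq_le {d : ℕ} {f : Torus d → ℂ} (hf : MemLp f 2)
    (E : Finset (Fin d → ℤ)) :
    (2 * π) ^ d * ∑ k ∈ E, ‖fCoeff f k‖ ^ 2 ≤ ∫ x, ‖f x‖ ^ 2 := by
  have hfi : Integrable f := hf.integrable (by norm_num)
  set g := trigPoly E (fCoeff f) with hg
  have h1 : ∀ x, ‖f x - g x‖ ^ 2 = ‖f x‖ ^ 2 - 2 * (conj (g x) * f x).re + ‖g x‖ ^ 2 := by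
    intro x
    simp only [← Complex.normSq_eq_norm_sq, Complex.normSq_sub, mul_comm (conj (g x))]
    ring
  have hgf : Integrable fun x => conj (g x) * f x := by
    obtain ⟨M, hM⟩ := (isCompact_univ.image (map_continuous g)).isBounded.exists_norm_le
    exact hfi.bdd_mul (c := M) (by fun_prop)
      (Filter.Eventually.of_forall fun x => by simpa using hM (g x) ⟨x, trivial, rfl⟩)
  have h2 : ∫ x, (conj (g x) * f x).re = (2 * π) ^ d * ∑ k ∈ E, ‖fCoeff f k‖ ^ 2 := by
    have h := integral_conj_trigPoly_mul hfi E (fCoeff f)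
    rw [← hg] at h
    have h' := congrArg Complex.re h
    rw [← RCLike.re_eq_complex_re, ← integral_re hgf] at h'
    simp only [RCLike.re_eq_complex_re] at h'
    rw [h', Complex.re_ofReal_mul, Complex.re_sum]
    congr 1
    refine Finset.sum_congr rfl fun k _ => ?_
    rw [Complex.conj_mul', ← Complex.ofReal_pow, Complex.ofReal_re]
  have h0 : 0 ≤ ∫ x, ‖f x - g x‖ ^ 2 := integral_nonneg fun x => by positivity
  have hf2 : Integrable fun x => ‖f x‖ ^ 2 := hf.integrable_norm_pow (by norm_num)
  have hg2 : Integrable fun x : Torus d => ‖g x‖ ^ 2 := integrable_of_continuous (by fun_prop)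
  have hre : Integrable fun x => 2 * (conj (g x) * f x).re := hgf.re.const_mul 2
  simp only [h1] at h0
  have h3 : Integrable fun x => ‖f x‖ ^ 2 - 2 * (conj (g x) * f x).re := hf2.sub hre
  rw [integral_add h3 hg2, integral_sub hf2 hre, integral_const_mul, h2, hg,
    integral_norm_trigPoly_sq] at h0
  linarith

lemma norm_fCoeff_le {d : ℕ} {f : Torus d → ℂ} {M : ℝ} (hM : ∀ x, ‖f x‖ ≤ M)
    (k : Fin d → ℤ) : ‖fCoeff f k‖ ≤ M := by
  have hpi : (0 : ℝ) < (2 * π) ^ d := by positivity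
  rw [fCoeff, norm_smul, norm_inv, Real.norm_of_nonneg hpi.le, inv_mul_le_iff₀ hpi]
  have := norm_integral_le_of_norm_le_const (μ := (volume : Measure (Torus d)))
    (f := fun x => conj (trigChar k x) * f x) (C := M)
    (Filter.Eventually.of_forall fun x => by
      rw [norm_mul, RCLike.norm_conj, norm_trigChar, one_mul]; exact hM x)
  rw [volume_torus] at this
  linarith

/-! ### Widths of Euclidean balls of trigonometric polynomials -/

lemma norm_prod_sub_prod_le {ι : Type*} (s : Finset ι) (a b : ι → ℂ) (ha : ∀ i, ‖a i‖ ≤ 1)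
    (hb : ∀ i, ‖b i‖ ≤ 1) : ‖∏ i ∈ s, a i - ∏ i ∈ s, b i‖ ≤ ∑ i ∈ s, ‖a i - b i‖ := by
  induction s using Finset.induction_on with
  | empty => simp
  | insert i s hi ih =>
    rw [Finset.prod_insert hi, Finset.prod_insert hi, Finset.sum_insert hi]
    have h1 : a i * ∏ x ∈ s, a x - b i * ∏ x ∈ s, b x =
        (a i - b i) * ∏ x ∈ s, a x + b i * (∏ x ∈ s, a x - ∏ x ∈ s, b x) := by ring
    rw [h1]
    refine (norm_add_le _ _).trans ?_
    rw [norm_mul, norm_mul]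
    have h2 : ‖∏ x ∈ s, a x‖ ≤ 1 := by
      rw [norm_prod]; exact Finset.prod_le_one (fun _ _ => norm_nonneg _) fun x _ => ha x
    have h3 := mul_le_of_le_one_right (norm_nonneg (a i - b i)) h2
    have h4 := mul_le_of_le_one_left (norm_nonneg (∏ x ∈ s, a x - ∏ x ∈ s, b x)) (hb i)
    linarith

lemma norm_fourier_sub_le (k : ℤ) (a b : ℝ) :
    ‖fourier k (a : AddCircle (2 * π)) - fourier k (b : AddCircle (2 * π))‖ ≤ |(k : ℝ)| * |a - b| := by
  have h0 : ∀ t : ℝ, fourier k (t : AddCircle (2 * π)) =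
      Complex.exp (Complex.I * ((k * t : ℝ) : ℂ)) := by
    intro t
    rw [fourier_coe_apply]
    congr 1
    have : (π : ℂ) ≠ 0 := by exact_mod_cast pi_ne_zero
    push_cast
    field_simp
  have h1 : fourier k (a : AddCircle (2 * π)) - fourier k (b : AddCircle (2 * π)) =
      fourier k (b : AddCircle (2 * π)) *
        (Complex.exp (Complex.I * ((k * (a - b) : ℝ) : ℂ)) - 1) := by
    rw [h0, h0, mul_sub, ← Complex.exp_add, mul_one]
    congr 2
    push_cast; ring
  rw [h1, norm_mul, show ‖fourier k (b : AddCircle (2 * π))‖ = 1 from Circle.norm_coe _, one_mul]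
  refine (Real.norm_exp_I_mul_ofReal_sub_one_le (x := k * (a - b))).trans_eq ?_
  rw [norm_eq_abs, abs_mul]

/-- The points of the equidistant grid with `P` points in each direction. -/
def gridPoint {d P : ℕ} (i : Fin d → Fin P) : Torus d :=
  fun j => ((2 * π * (i j : ℕ) / P : ℝ) : AddCircle (2 * π))

lemma exists_gridPoint_near {d P : ℕ} (hP : 0 < P) (x : Torus d) : ∃ i : Fin d → Fin P,
    ∀ (k : Fin d → ℤ) (R : ℝ), (∀ j, |(k j : ℝ)| ≤ R) →
      ‖trigChar k x - trigChar k (gridPoint i)‖ ≤ d * (R * (2 * π / P)) := by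
  have hP' : (0 : ℝ) < P := by exact_mod_cast hP
  have hpi := pi_pos
  have h1 : ∀ j, ∃ i : Fin P, ∃ θ : ℝ, x j = (θ : AddCircle (2 * π)) ∧
      |θ - 2 * π * (i : ℕ) / P| ≤ 2 * π / P := by
    intro j
    obtain ⟨θ, ⟨hθ0, hθ1⟩, hθ⟩ := (AddCircle.eq_coe_Ico (x j))
    set t := θ * P / (2 * π) with ht
    have ht0 : 0 ≤ t := by positivity
    have htP : t < P := by rw [ht, div_lt_iff₀ (by positivity)]; nlinarith
    refine ⟨⟨⌊t⌋₊, (Nat.floor_lt ht0).2 htP⟩, θ, hθ.symm, ?_⟩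
    have h2 := Nat.floor_le ht0
    have h3 := Nat.lt_floor_add_one t
    have hθt : θ = t * (2 * π / P) := by rw [ht]; field_simp
    have h4 : θ - 2 * π * (⌊t⌋₊ : ℕ) / P = (t - ⌊t⌋₊) * (2 * π / P) := by rw [hθt]; ring
    simp only
    rw [h4, abs_of_nonneg (by have : 0 ≤ t - ⌊t⌋₊ := by linarith
                              positivity)]
    exact mul_le_of_le_one_left (by positivity) (by linarith)
  choose i θ hθ hi using h1
  refine ⟨i, fun k R hR => ?_⟩
  rw [trigChar_apply, trigChar_apply]
  refine (norm_prod_sub_prod_le _ _ _ (fun j => (Circle.norm_coe _).le)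
    (fun j => (Circle.norm_coe _).le)).trans ?_
  refine (Finset.sum_le_card_nsmul _ _ (R * (2 * π / P)) fun j _ => ?_).trans_eq (by simp)
  rw [hθ j, gridPoint]
  refine (norm_fourier_sub_le _ _ _).trans ?_
  exact mul_le_mul (hR j) (hi j) (abs_nonneg _) ((abs_nonneg _).trans (hR j))

lemma norm_trigPoly_le_of_grid {d P : ℕ} (hP : 0 < P) {Q : Finset (Fin d → ℤ)} {R : ℝ}
    (hQ : ∀ k ∈ Q, ∀ j, |(k j : ℝ)| ≤ R) (hPR : 4 * π * d * R * Q.card ≤ P)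
    (c : (Fin d → ℤ) → ℂ) {A : ℝ} (hA : ∀ i : Fin d → Fin P, ‖trigPoly Q c (gridPoint i)‖ ≤ A)
    (x : Torus d) : ‖trigPoly Q c x‖ ≤ 2 * A := by
  obtain ⟨x0, -, hx0⟩ := isCompact_univ.exists_isMaxOn (Set.univ_nonempty)
    (f := fun x : Torus d => ‖trigPoly Q c x‖) (by fun_prop)
  have hmax : ∀ y, ‖trigPoly Q c y‖ ≤ ‖trigPoly Q c x0‖ := fun y => hx0 (Set.mem_univ y)
  refine (hmax x).trans ?_
  set M := ‖trigPoly Q c x0‖ with hM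
  have hM0 : 0 ≤ M := norm_nonneg _
  have hP' : (0 : ℝ) < P := by exact_mod_cast hP
  obtain ⟨i, hi⟩ := exists_gridPoint_near hP x0
  have hc : ∀ k ∈ Q, ‖c k‖ ≤ M := by
    intro k hk
    have := norm_fCoeff_le hmax k
    rwa [fCoeff_trigPoly, if_pos hk] at this
  have h1 : ‖trigPoly Q c x0 - trigPoly Q c (gridPoint i)‖ ≤ M / 2 := by
    rw [trigPoly_apply, trigPoly_apply, ← Finset.sum_sub_distrib]
    refine (norm_sum_le _ _).trans ?_
    have h2 : ∀ k ∈ Q, ‖c k * trigChar k x0 - c k * trigChar k (gridPoint i)‖ ≤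
        M * (d * (R * (2 * π / P))) := by
      intro k hk
      rw [← mul_sub, norm_mul]
      exact mul_le_mul (hc k hk) (hi k R (hQ k hk)) (norm_nonneg _) hM0
    refine (Finset.sum_le_card_nsmul _ _ _ h2).trans ?_
    rw [nsmul_eq_mul]
    have h3 : (Q.card : ℝ) * (M * (d * (R * (2 * π / P)))) =
        M * ((4 * π * d * R * Q.card) / P) / 2 := by ring
    rw [h3]
    have h4 : 4 * π * d * R * Q.card / P ≤ 1 := by rw [div_le_one hP']; exact hPR
    have := mul_le_of_le_one_right hM0 h4
    linarith
  have h5 := norm_sub_norm_le (trigPoly Q c x0) (trigPoly Q c (gridPoint i))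
  have := hA i
  linarith

lemma exists_subspace_approx_trigPoly {d m P : ℕ} (hm : 1 ≤ m) (hP : 0 < P)
    {Q : Finset (Fin d → ℤ)} {R : ℝ}
    (hQ : ∀ k ∈ Q, ∀ j, |(k j : ℝ)| ≤ R) (hPR : 4 * π * d * R * Q.card ≤ P)
    {Lg : ℝ} (hL : 1 ≤ Lg) (hPL : (P : ℝ) ^ d ≤ exp Lg) :
    ∃ V : Submodule ℂ C(Torus d, ℂ), FiniteDimensional ℂ V ∧ Module.finrank ℂ V < m ∧
      ∀ c : (Fin d → ℤ) → ℂ, ∃ b ∈ V, ∀ x, ‖trigPoly Q c x - b x‖ ≤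
        2 * (sqrt (300000 * Q.card * Lg / m) * sqrt (∑ k ∈ Q, ‖c k‖ ^ 2)) := by
  set κ : Fin Q.card → (Fin d → ℤ) := fun l => (Q.equivFin.symm l : Fin d → ℤ) with hκ
  have hsum : ∀ {β : Type} [AddCommMonoid β] (F : (Fin d → ℤ) → β),
      ∑ l, F (κ l) = ∑ k ∈ Q, F k := by
    intro β _ F
    rw [← Finset.sum_coe_sort Q]
    exact Q.equivFin.symm.sum_comp (fun k : Q => F k)
  obtain ⟨V, hV, hVa⟩ := exists_subspace_approx_sup (ι := Fin d → Fin P) (n := Q.card) hm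
    (fun i l => trigChar (κ l) (gridPoint i)) (fun i l => (norm_trigChar _ _).le) hL
    (by simpa using hPL)
  set Φ : (Fin Q.card → ℂ) →ₗ[ℂ] C(Torus d, ℂ) :=
    Fintype.linearCombination ℂ (fun l => trigChar (κ l)) with hΦ
  refine ⟨V.map Φ, inferInstance, (Submodule.finrank_map_le Φ V).trans_lt hV, fun c => ?_⟩
  obtain ⟨b, hb, hbi⟩ := hVa fun l => c (κ l)
  refine ⟨Φ b, Submodule.mem_map_of_mem hb, fun x => ?_⟩
  set c' : (Fin d → ℤ) → ℂ := fun k => if hk : k ∈ Q then c k - b (Q.equivFin ⟨k, hk⟩) else 0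
    with hc'
  have hc'κ : ∀ l, c' (κ l) = c (κ l) - b l := by
    intro l
    have hmem : κ l ∈ Q := (Q.equivFin.symm l).2
    simp only [hc', dif_pos hmem]
    congr 2
    exact Q.equivFin.apply_symm_apply l
  have hdiff : ∀ y, trigPoly Q c y - Φ b y = trigPoly Q c' y := by
    intro y
    rw [trigPoly_apply, trigPoly_apply, ← hsum fun k => c k * trigChar k y,
      ← hsum fun k => c' k * trigChar k y, hΦ, Fintype.linearCombination_apply,
      ContinuousMap.sum_apply, ← Finset.sum_sub_distrib]
    refine Finset.sum_congr rfl fun l _ => ?_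
    rw [hc'κ, sub_mul]; rfl
  rw [hdiff]
  refine norm_trigPoly_le_of_grid hP hQ hPR c' (fun i => ?_) x
  have := hbi i
  rw [hsum fun k => ‖c k‖ ^ 2] at this
  refine le_trans (le_of_eq ?_) this
  rw [trigPoly_apply, ← hsum fun k => c' k * trigChar k (gridPoint i)]
  congr 1
  exact Finset.sum_congr rfl fun l _ => by rw [hc'κ]; ring

/-! ### Boundedness of frequency projections on boxes -/

/-- Trigonometric polynomials with frequencies in `H`. -/
def trigSpan {d : ℕ} (H : Set (Fin d → ℤ)) : Submodule ℂ C(Torus d, ℂ) :=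
  Submodule.span ℂ (trigChar '' H)

/-- The frequency projection onto `H` has `q`-th power norm at most `C` in `L_q`. -/
def ProjBound {d : ℕ} (H : Set (Fin d → ℤ)) (q : ℕ) (C : ℝ) : Prop :=
  ∀ a ∈ trigSpan H, ∀ b ∈ trigSpan Hᶜ,
    ∫ x : Torus d, ‖a x‖ ^ q ≤ C * ∫ x : Torus d, ‖a x + b x‖ ^ q

lemma trigChar_mem_trigSpan {d : ℕ} {H : Set (Fin d → ℤ)} {k : Fin d → ℤ} (hk : k ∈ H) :
    trigChar k ∈ trigSpan H := Submodule.subset_span ⟨k, hk, rfl⟩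

lemma trigSpan_mono {d : ℕ} {H H' : Set (Fin d → ℤ)} (h : H ⊆ H') : trigSpan H ≤ trigSpan H' :=
  Submodule.span_mono (Set.image_mono h)

lemma trigSpan_union {d : ℕ} (H H' : Set (Fin d → ℤ)) :
    trigSpan (H ∪ H') = trigSpan H ⊔ trigSpan H' := by
  rw [trigSpan, Set.image_union, Submodule.span_union]; rfl

lemma trigPoly_mem_trigSpan {d : ℕ} {H : Set (Fin d → ℤ)} {E : Finset (Fin d → ℤ)}
    (hE : ∀ k ∈ E, k ∈ H) (c : (Fin d → ℤ) → ℂ) : trigPoly E c ∈ trigSpan H :=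
  Submodule.sum_mem _ fun k hk => Submodule.smul_mem _ _ (trigChar_mem_trigSpan (hE k hk))

lemma mul_mem_trigSpan {d : ℕ} {H : Set (Fin d → ℤ)} (hH : ∀ k ∈ H, ∀ l ∈ H, k + l ∈ H)
    {a b : C(Torus d, ℂ)} (ha : a ∈ trigSpan H) (hb : b ∈ trigSpan H) :
    a * b ∈ trigSpan H := by
  induction ha, hb using Submodule.span_induction₂ with
  | mem_mem x y hx hy =>
    obtain ⟨k, hk, rfl⟩ := hx
    obtain ⟨l, hl, rfl⟩ := hy
    have : trigChar k * trigChar l = trigChar (k + l) := by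
      ext x; exact (trigChar_add k l x).symm
    rw [this]
    exact trigChar_mem_trigSpan (hH k hk l hl)
  | zero_left => simp
  | zero_right => simp
  | add_left x y z _ _ _ h1 h2 => rw [add_mul]; exact add_mem h1 h2
  | add_right x y z _ _ _ h1 h2 => rw [mul_add]; exact add_mem h1 h2
  | smul_left r x y _ _ h => rw [smul_mul_assoc]; exact Submodule.smul_mem _ _ h
  | smul_right r x y _ _ h => rw [mul_smul_comm]; exact Submodule.smul_mem _ _ h

lemma integral_conj_mul_eq_zero {d : ℕ} {H : Set (Fin d → ℤ)} {a b : C(Torus d, ℂ)}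
    (ha : a ∈ trigSpan H) (hb : b ∈ trigSpan Hᶜ) : ∫ x, conj (a x) * b x = 0 := by
  induction ha, hb using Submodule.span_induction₂ with
  | mem_mem x y hx hy =>
    obtain ⟨k, hk, rfl⟩ := hx
    obtain ⟨l, hl, rfl⟩ := hy
    rw [integral_conj_trigChar_mul, if_neg]
    rintro rfl
    exact hl hk
  | zero_left => simp
  | zero_right => simp
  | add_left x y z _ _ _ h1 h2 =>
    simp only [ContinuousMap.add_apply, map_add, add_mul]
    rw [integral_add (integrable_of_continuous (by fun_prop))
      (integrable_of_continuous (by fun_prop)), h1, h2, add_zero]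
  | add_right x y z _ _ _ h1 h2 =>
    simp only [ContinuousMap.add_apply, mul_add]
    rw [integral_add (integrable_of_continuous (by fun_prop))
      (integrable_of_continuous (by fun_prop)), h1, h2, add_zero]
  | smul_left r x y _ _ h =>
    simp only [ContinuousMap.smul_apply, smul_eq_mul, map_mul, mul_assoc]
    rw [integral_const_mul, h, mul_zero]
  | smul_right r x y _ _ h =>
    simp only [ContinuousMap.smul_apply, smul_eq_mul, mul_left_comm _ r]
    rw [integral_const_mul, h, mul_zero]

lemma projBound_two {d : ℕ} (H : Set (Fin d → ℤ)) : ProjBound H 2 1 := by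
  intro a ha b hb
  have h0 := integral_conj_mul_eq_zero ha hb
  have h1 : ∀ x, ‖a x + b x‖ ^ 2 = ‖a x‖ ^ 2 + ‖b x‖ ^ 2 + 2 * (conj (a x) * b x).re := by
    intro x
    simp only [← Complex.normSq_eq_norm_sq, Complex.normSq_add]
    congr 2
    simp only [Complex.mul_re, Complex.conj_re, Complex.conj_im]; ring
  have h2 : ∫ x, (conj (a x) * b x).re = 0 := by
    have := integral_re (𝕜 := ℂ) (μ := (volume : Measure (Torus d)))
      (f := fun x => conj (a x) * b x) (integrable_of_continuous (by fun_prop))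
    rw [h0] at this
    simpa using this
  have ia : Integrable fun x => ‖a x‖ ^ 2 := integrable_of_continuous (by fun_prop)
  have ib : Integrable fun x => ‖b x‖ ^ 2 := integrable_of_continuous (by fun_prop)
  have iab : Integrable fun x => ‖a x‖ ^ 2 + ‖b x‖ ^ 2 := ia.add ib
  have ic : Integrable fun x => 2 * (conj (a x) * b x).re :=
    integrable_of_continuous (by fun_prop)
  simp only [h1]
  rw [integral_add iab ic, integral_add ia ib, integral_const_mul, h2]
  have : 0 ≤ ∫ x, ‖b x‖ ^ 2 := integral_nonneg fun x => by positivity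
  linarith

lemma add_pow_le_two_pow_mul {x y : ℝ} (hx : 0 ≤ x) (hy : 0 ≤ y) (q : ℕ) :
    (x + y) ^ q ≤ 2 ^ q * (x ^ q + y ^ q) := by
  rcases le_total x y with h | h
  · calc (x + y) ^ q ≤ (2 * y) ^ q := by gcongr; linarith
      _ = 2 ^ q * y ^ q := mul_pow _ _ _
      _ ≤ _ := by gcongr; have := pow_nonneg hx q; linarith
  · calc (x + y) ^ q ≤ (2 * x) ^ q := by gcongr; linarith
      _ = 2 ^ q * x ^ q := mul_pow _ _ _
      _ ≤ _ := by gcongr; have := pow_nonneg hy q; linarith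

/-- Cotlar's doubling argument. -/
lemma ProjBound.two_mul {d : ℕ} {H : Set (Fin d → ℤ)} (h1 : ∀ k ∈ H, ∀ l ∈ H, k + l ∈ H)
    (h2 : ∀ k ∈ Hᶜ, ∀ l ∈ Hᶜ, k + l ∈ Hᶜ) {q : ℕ} {C : ℝ} (hC : 0 ≤ C) (h : ProjBound H q C) :
    ProjBound H (2 * q) ((C * 4 ^ q) ^ 2 + 2 * (C * 4 ^ q)) := by
  intro a ha b hb
  have h3 := h (a * a) (mul_mem_trigSpan h1 ha ha) (-(b * b))
    (neg_mem (mul_mem_trigSpan h2 hb hb))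
  set K := C * 4 ^ q with hK
  have hK0 : 0 ≤ K := by positivity
  have h4 : ∀ x, C * ‖(a * a) x + (-(b * b)) x‖ ^ q ≤
      1 / 2 * ‖a x‖ ^ (2 * q) + (K ^ 2 / 2 + K) * ‖a x + b x‖ ^ (2 * q) := by
    intro x
    have e1 : (a * a) x + (-(b * b)) x = (a x + b x) * (2 * a x - (a x + b x)) := by
      simp only [ContinuousMap.mul_apply, ContinuousMap.neg_apply]; ring
    rw [e1, norm_mul, mul_pow]
    set u := ‖a x‖
    set v := ‖a x + b x‖
    have hu : 0 ≤ u := norm_nonneg _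
    have hv : 0 ≤ v := norm_nonneg _
    have e2 : ‖2 * a x - (a x + b x)‖ ≤ 2 * u + v := by
      refine (norm_sub_le _ _).trans ?_
      rw [norm_mul]; simp [u, v]
    have e3 : ‖2 * a x - (a x + b x)‖ ^ q ≤ 4 ^ q * (u ^ q + v ^ q) := by
      refine (pow_le_pow_left₀ (norm_nonneg _) e2 q).trans ?_
      refine (add_pow_le_two_pow_mul (by positivity) hv q).trans ?_
      have : (4 : ℝ) ^ q = 2 ^ q * 2 ^ q := by rw [← mul_pow]; norm_num
      rw [mul_pow, this]
      have h1q : (1 : ℝ) ≤ 2 ^ q := one_le_pow₀ (by norm_num)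
      have := mul_le_mul_of_nonneg_right h1q (pow_nonneg hv q)
      rw [mul_assoc]
      gcongr
      linarith
    have hvq : 0 ≤ v ^ q := pow_nonneg hv q
    calc C * (v ^ q * ‖2 * a x - (a x + b x)‖ ^ q) ≤ C * (v ^ q * (4 ^ q * (u ^ q + v ^ q))) := by
          gcongr
      _ = K * v ^ q * u ^ q + K * (v ^ q) ^ 2 := by rw [hK]; ring
      _ ≤ 1 / 2 * (u ^ q) ^ 2 + (K ^ 2 / 2 + K) * (v ^ q) ^ 2 := by
          nlinarith [sq_nonneg (K * v ^ q - u ^ q)]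
      _ = _ := by rw [mul_comm 2 q, pow_mul, pow_mul]
  have ia : Integrable fun x => ‖a x‖ ^ (2 * q) := integrable_of_continuous (by fun_prop)
  have iab : Integrable fun x => ‖a x + b x‖ ^ (2 * q) := integrable_of_continuous (by fun_prop)
  have h5 : ∫ x, ‖(a * a) x‖ ^ q = ∫ x, ‖a x‖ ^ (2 * q) := by
    congr 1; ext x
    rw [ContinuousMap.mul_apply, norm_mul, pow_mul, sq]
  rw [h5, ← integral_const_mul] at h3
  have h6 := h3.trans (integral_mono
    (integrable_of_continuous (by fun_prop)) ((ia.const_mul _).add (iab.const_mul _)) h4)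
  simp only [Pi.add_apply] at h6
  rw [integral_add (ia.const_mul _) (iab.const_mul _), integral_const_mul,
    integral_const_mul] at h6
  linarith

lemma exists_projBound_of_add_closed (d K : ℕ) : ∃ C : ℝ, 0 < C ∧ ∀ H : Set (Fin d → ℤ),
    (∀ k ∈ H, ∀ l ∈ H, k + l ∈ H) → (∀ k ∈ Hᶜ, ∀ l ∈ Hᶜ, k + l ∈ Hᶜ) →
      ProjBound H (2 ^ (K + 1)) C := by
  induction K with
  | zero => exact ⟨1, one_pos, fun H _ _ => by simpa using projBound_two H⟩
  | succ K ih =>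
    obtain ⟨C, hC, h⟩ := ih
    refine ⟨(C * 4 ^ 2 ^ (K + 1)) ^ 2 + 2 * (C * 4 ^ 2 ^ (K + 1)), by positivity,
      fun H h1 h2 => ?_⟩
    rw [pow_succ _ (K + 1), mul_comm _ 2]
    exact (h H h1 h2).two_mul h1 h2 hC.le

lemma ProjBound.shift {d : ℕ} {H : Set (Fin d → ℤ)} {q : ℕ} {C : ℝ} (h : ProjBound H q C)
    (v : Fin d → ℤ) : ProjBound {k | k + v ∈ H} q C := by
  have key : ∀ (G : Set (Fin d → ℤ)) (a : C(Torus d, ℂ)), a ∈ trigSpan {k | k + v ∈ G} →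
      trigChar v * a ∈ trigSpan G := by
    intro G a ha
    induction ha using Submodule.span_induction with
    | mem x hx =>
      obtain ⟨k, hk, rfl⟩ := hx
      have : trigChar v * trigChar k = trigChar (k + v) := by
        ext x; rw [trigChar_add]; exact mul_comm _ _
      rw [this]
      exact trigChar_mem_trigSpan hk
    | zero => simp
    | add x y _ _ h1 h2 => rw [mul_add]; exact add_mem h1 h2
    | smul r x _ h => rw [mul_smul_comm]; exact Submodule.smul_mem _ _ h
  intro a ha b hb
  have h3 := h _ (key H a ha) _ (key Hᶜ b hb)
  simpa only [ContinuousMap.mul_apply, ← mul_add, norm_mul, norm_trigChar, one_mul] using h3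

lemma ProjBound.compl {d : ℕ} {H : Set (Fin d → ℤ)} {q : ℕ} {C : ℝ} (h : ProjBound H q C) :
    ProjBound Hᶜ q (2 ^ q * (1 + C)) := by
  intro b hb a ha
  rw [compl_compl] at ha
  have h1 := h a ha b hb
  have ia : Integrable fun x => ‖a x‖ ^ q := integrable_of_continuous (by fun_prop)
  have iab : Integrable fun x => ‖b x + a x‖ ^ q := integrable_of_continuous (by fun_prop)
  have h2 : ∀ x, ‖b x‖ ^ q ≤ 2 ^ q * (‖b x + a x‖ ^ q + ‖a x‖ ^ q) := by
    intro x
    refine le_trans ?_ (add_pow_le_two_pow_mul (norm_nonneg _) (norm_nonneg _) q)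
    gcongr
    have := norm_sub_le (b x + a x) (a x)
    rwa [add_sub_cancel_right] at this
  have h3 := integral_mono (integrable_of_continuous (by fun_prop)) ((iab.add ia).const_mul (2 ^ q)) h2
  simp only [Pi.add_apply] at h3
  rw [integral_const_mul, integral_add iab ia] at h3
  simp only [add_comm (a _)] at h1
  refine h3.trans ?_
  rw [mul_assoc]
  gcongr
  linarith

lemma ProjBound.inter {d : ℕ} {H H' : Set (Fin d → ℤ)} {q : ℕ} {C C' : ℝ} (hC' : 0 ≤ C')
    (h : ProjBound H q C) (h' : ProjBound H' q C') : ProjBound (H ∩ H') q (C' * C) := by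
  intro a ha b hb
  have hu : (H ∩ H')ᶜ = (H ∩ H'ᶜ) ∪ Hᶜ := by
    ext k; simp only [Set.mem_compl_iff, Set.mem_inter_iff, Set.mem_union]; tauto
  rw [hu, trigSpan_union, Submodule.mem_sup] at hb
  obtain ⟨b1, hb1, b2, hb2, rfl⟩ := hb
  have h1 := h (a + b1) (add_mem (trigSpan_mono Set.inter_subset_left ha)
    (trigSpan_mono Set.inter_subset_left hb1)) b2 hb2
  have h2 := h' a (trigSpan_mono Set.inter_subset_right ha) b1
    (trigSpan_mono Set.inter_subset_right hb1)
  simp only [ContinuousMap.add_apply, add_assoc] at h1 ⊢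
  rw [mul_assoc]
  exact h2.trans (mul_le_mul_of_nonneg_left h1 hC')

lemma projBound_univ {d : ℕ} (q : ℕ) : ProjBound (Set.univ : Set (Fin d → ℤ)) q 1 := by
  intro a _ b hb
  have : b = 0 := by simpa [trigSpan] using hb
  simp [this]

lemma exists_projBound_box (d K : ℕ) : ∃ C : ℝ, 0 < C ∧ ∀ lo hi : Fin d → ℤ,
    ProjBound {k : Fin d → ℤ | ∀ j, lo j ≤ |k j| ∧ |k j| < hi j} (2 ^ (K + 1)) C := by
  obtain ⟨C, hC, h⟩ := exists_projBound_of_add_closed d K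
  set q := 2 ^ (K + 1) with hq
  have hhalf : ∀ (j : Fin d) (v : ℤ), ProjBound {k : Fin d → ℤ | v ≤ k j} q C := by
    intro j v
    have h1 := (h {k | 0 ≤ k j} (fun k hk l hl => by
      simp only [Set.mem_ofPred_eq, Pi.add_apply] at hk hl ⊢
      exact add_nonneg hk hl) (fun k hk l hl => by
      simp only [Set.mem_compl_iff, Set.mem_ofPred_eq, not_le, Pi.add_apply] at hk hl ⊢
      exact add_neg hk hl)).shift (fun _ => -v)
    simpa using h1
  set C1 := 2 ^ q * (1 + C) * C with hC1
  have hC1p : 0 < C1 := by positivity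
  have hslab : ∀ (j : Fin d) (v : ℤ), ProjBound {k : Fin d → ℤ | |k j| < v} q C1 := by
    intro j v
    have h1 := (hhalf j (-v + 1)).inter (by positivity) (hhalf j v).compl
    have : {k : Fin d → ℤ | |k j| < v} = {k | -v + 1 ≤ k j} ∩ {k | v ≤ k j}ᶜ := by
      ext k
      simp only [Set.mem_ofPred_eq, Set.mem_inter_iff, Set.mem_compl_iff, abs_lt]
      omega
    rw [this]; exact h1
  set C2 := C1 * (2 ^ q * (1 + C1)) with hC2
  have hC2p : 0 < C2 := by positivity
  have hann : ∀ (j : Fin d) (u v : ℤ),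
      ProjBound {k : Fin d → ℤ | u ≤ |k j| ∧ |k j| < v} q C2 := by
    intro j u v
    have h1 := (hslab j u).compl.inter hC1p.le (hslab j v)
    have : {k : Fin d → ℤ | u ≤ |k j| ∧ |k j| < v} = {k | |k j| < u}ᶜ ∩ {k | |k j| < v} := by
      ext k
      simp only [Set.mem_ofPred_eq, Set.mem_inter_iff, Set.mem_compl_iff, not_lt]
    rw [this]; exact h1
  refine ⟨C2 ^ d, by positivity, fun lo hi => ?_⟩
  have hfin : ∀ s : Finset (Fin d),
      ProjBound {k : Fin d → ℤ | ∀ j ∈ s, lo j ≤ |k j| ∧ |k j| < hi j} q (C2 ^ s.card) := by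
    intro s
    induction s using Finset.induction_on with
    | empty => simpa using projBound_univ q
    | insert i s hi' ih =>
      have h1 := ih.inter hC2p.le (hann i (lo i) (hi i))
      rw [Finset.card_insert_of_notMem hi', pow_succ, mul_comm]
      convert h1 using 1
      ext k
      simp only [Finset.forall_mem_insert, Set.mem_ofPred_eq, Set.mem_inter_iff]
      tauto
  simpa using hfin Finset.univ

/-! ### Smooth frequency multipliers -/

/-- The multiplier of a de la Vallée-Poussin type kernel, equal to `1` for `|k| ≤ N` and to `0`
for `|k| ≥ 2N`. -/
def vpMult (N : ℕ) (k : ℤ) : ℝ :=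
  (∑ a ∈ Finset.range N, if k - a ∈ Finset.Ioc (-2 * N : ℤ) N then (1 : ℝ) else 0) / N

lemma vpMult_nonneg (N : ℕ) (k : ℤ) : 0 ≤ vpMult N k :=
  div_nonneg (Finset.sum_nonneg fun _ _ => by split_ifs <;> norm_num) (Nat.cast_nonneg _)

lemma vpMult_le_one (N : ℕ) (k : ℤ) : vpMult N k ≤ 1 := by
  refine div_le_one_of_le₀ ?_ (Nat.cast_nonneg _)
  refine (Finset.sum_le_card_nsmul _ _ 1 fun _ _ => by split_ifs <;> norm_num).trans_eq ?_
  simp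

lemma vpMult_eq_one {N : ℕ} (hN : 0 < N) {k : ℤ} (hk : |k| ≤ N) : vpMult N k = 1 := by
  rw [abs_le] at hk
  rw [vpMult, div_eq_one_iff_eq (by exact_mod_cast hN.ne')]
  rw [Finset.sum_congr rfl fun a ha => if_pos ?_]
  · simp
  · rw [Finset.mem_range] at ha
    rw [Finset.mem_Ioc]; omega

lemma vpMult_eq_zero {N : ℕ} {k : ℤ} (hk : 2 * N ≤ |k|) : vpMult N k = 0 := by
  rw [le_abs] at hk
  rw [vpMult, Finset.sum_eq_zero, zero_div]
  intro a ha
  rw [Finset.mem_range] at ha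
  rw [if_neg]
  rw [Finset.mem_Ioc]; omega

lemma integral_norm_sum_fourier_sq (A : Finset ℤ) :
    ∫ x : AddCircle (2 * π), ‖∑ a ∈ A, (fourier a x : ℂ)‖ ^ 2 = 2 * π * A.card := by
  have hint : ∀ f : C(AddCircle (2 * π), ℂ), Integrable (fun x => f x) := fun f =>
    f.continuous.integrable_of_hasCompactSupport (HasCompactSupport.of_compactSpace _)
  have h1 : ∀ x : AddCircle (2 * π), ((‖∑ a ∈ A, (fourier a x : ℂ)‖ ^ 2 : ℝ) : ℂ) =
      ∑ a ∈ A, ∑ b ∈ A, fourier (-a + b) x := by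
    intro x
    rw [Complex.ofReal_pow, ← Complex.conj_mul', map_sum, Finset.sum_mul_sum]
    simp only [fourier_add, fourier_neg]
  have h2 : ((∫ x : AddCircle (2 * π), ‖∑ a ∈ A, (fourier a x : ℂ)‖ ^ 2 : ℝ) : ℂ) =
      ((2 * π * A.card : ℝ) : ℂ) := by
    rw [← integral_complex_ofReal]
    simp only [h1]
    rw [integral_finsetSum _ fun a _ => integrable_finsetSum _ fun b _ => hint _]
    have h3 : ∀ a ∈ A, ∫ x : AddCircle (2 * π), ∑ b ∈ A, (fourier (-a + b) x : ℂ) =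
        ((2 * π : ℝ) : ℂ) := by
      intro a ha
      rw [integral_finsetSum _ fun b _ => hint _]
      simp only [integral_fourier, neg_add_eq_zero, Finset.sum_ite_eq, if_pos ha]
    rw [Finset.sum_congr rfl h3, Finset.sum_const, nsmul_eq_mul]
    push_cast; ring
  exact_mod_cast h2

lemma sum_vpMult_mul {N : ℕ} {E : Finset ℤ} (hE : Finset.Ioo (-2 * N : ℤ) (2 * N) ⊆ E)
    (x : AddCircle (2 * π)) :
    ∑ k ∈ E, (vpMult N k : ℂ) * fourier k x =
      (∑ a ∈ (Finset.range N).map Nat.castEmbedding, fourier (a : ℤ) x) *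
        (∑ b ∈ Finset.Ioc (-2 * N : ℤ) N, fourier b x) / N := by
  have h1 : ∀ a ∈ Finset.range N, ∑ b ∈ Finset.Ioc (-2 * N : ℤ) N, (fourier ((a : ℤ) + b) x : ℂ) =
      ∑ k ∈ E, if k - a ∈ Finset.Ioc (-2 * N : ℤ) N then (fourier k x : ℂ) else 0 := by
    intro a ha
    rw [← Finset.sum_filter]
    refine Finset.sum_bij' (fun b _ => (a : ℤ) + b) (fun k _ => k - a) ?_ ?_ ?_ ?_ ?_
    · intro b hb
      rw [Finset.mem_range] at ha
      rw [Finset.mem_filter]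
      refine ⟨hE ?_, by simpa using hb⟩
      rw [Finset.mem_Ioc] at hb
      rw [Finset.mem_Ioo]; omega
    · intro k hk; exact (Finset.mem_filter.1 hk).2
    · intro b _; ring
    · intro k _; ring
    · intro b _; rfl
  rw [Finset.sum_map, Finset.sum_mul_sum]
  simp only [← fourier_add]
  refine Eq.trans ?_ (congrArg (fun z : ℂ => z / N) (Finset.sum_congr rfl h1).symm)
  rw [Finset.sum_comm, Finset.sum_div]
  refine Finset.sum_congr rfl fun k _ => ?_
  rw [vpMult]
  push_cast
  rw [div_mul_eq_mul_div, Finset.sum_mul]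
  congr 1
  exact Finset.sum_congr rfl fun a _ => by split_ifs <;> simp

lemma integral_norm_vpKernel_le {N : ℕ} (hN : 0 < N) {E : Finset ℤ}
    (hE : Finset.Ioo (-2 * N : ℤ) (2 * N) ⊆ E) :
    ∫ x : AddCircle (2 * π), ‖∑ k ∈ E, (vpMult N k : ℂ) * fourier k x‖ ≤ 4 * π := by
  have hint : ∀ f : AddCircle (2 * π) → ℝ, Continuous f → Integrable f := fun f hf =>
    hf.integrable_of_hasCompactSupport (HasCompactSupport.of_compactSpace _)
  have hN' : (0 : ℝ) < N := by exact_mod_cast hN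
  set A := (Finset.range N).map (Nat.castEmbedding (R := ℤ)) with hA
  set B := Finset.Ioc (-2 * N : ℤ) N with hB
  have iA : Integrable fun x : AddCircle (2 * π) => ‖∑ a ∈ A, (fourier a x : ℂ)‖ ^ 2 :=
    hint _ (by fun_prop)
  have iB : Integrable fun x : AddCircle (2 * π) => ‖∑ a ∈ B, (fourier a x : ℂ)‖ ^ 2 :=
    hint _ (by fun_prop)
  have hAB : ∀ x : AddCircle (2 * π), ‖∑ k ∈ E, (vpMult N k : ℂ) * fourier k x‖ ≤
      (1 / (2 * N)) * (‖∑ a ∈ A, (fourier a x : ℂ)‖ ^ 2 + ‖∑ a ∈ B, (fourier a x : ℂ)‖ ^ 2) := by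
    intro x
    rw [sum_vpMult_mul hE, norm_div, norm_mul, Complex.norm_natCast, div_le_iff₀ hN']
    have : 1 / (2 * (N : ℝ)) * (‖∑ a ∈ A, (fourier a x : ℂ)‖ ^ 2 +
        ‖∑ a ∈ B, (fourier a x : ℂ)‖ ^ 2) * N =
        (‖∑ a ∈ A, (fourier a x : ℂ)‖ ^ 2 + ‖∑ a ∈ B, (fourier a x : ℂ)‖ ^ 2) / 2 := by
      field_simp
    rw [this]
    nlinarith [sq_nonneg (‖∑ a ∈ A, (fourier a x : ℂ)‖ - ‖∑ a ∈ B, (fourier a x : ℂ)‖)]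
  refine (integral_mono (hint _ (by fun_prop)) ((iA.add iB).const_mul _) hAB).trans_eq ?_
  simp only [Pi.add_apply]
  rw [integral_const_mul, integral_add iA iB, integral_norm_sum_fourier_sq,
    integral_norm_sum_fourier_sq, hA, hB, Finset.card_map, Finset.card_range, Int.card_Ioc]
  have h3 : (((N : ℤ) - -2 * N).toNat : ℝ) = 3 * N := by
    have : ((N : ℤ) - -2 * N).toNat = 3 * N := by omega
    rw [this]; push_cast; ring
  rw [h3]
  field_simp
  ring

/-- One-dimensional dyadic multiplier: low-pass at level `s` or band-pass at level `s`. -/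
def dyadicMult (low : Prop) (s : ℕ) (k : ℤ) : ℝ :=
  vpMult (2 ^ s) k - if low ∨ s < 2 then 0 else vpMult (2 ^ (s - 2)) k

lemma abs_dyadicMult_le (low : Prop) (s : ℕ) (k : ℤ) : |dyadicMult low s k| ≤ 1 := by
  have h1 := vpMult_nonneg (2 ^ s) k
  have h2 := vpMult_le_one (2 ^ s) k
  have h3 := vpMult_nonneg (2 ^ (s - 2)) k
  have h4 := vpMult_le_one (2 ^ (s - 2)) k
  rw [dyadicMult, abs_le]
  split_ifs <;> constructor <;> linarith

lemma dyadicMult_eq_one {low : Prop} {s : ℕ} {k : ℤ} (hk : |k| < 2 ^ s)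
    (hk2 : ¬ low → 2 ^ s / 2 ≤ |k|) : dyadicMult low s k = 1 := by
  rw [dyadicMult, vpMult_eq_one (by positivity) (by push_cast; exact hk.le)]
  split_ifs with h
  · simp
  · push Not at h
    obtain ⟨t, rfl⟩ := Nat.exists_eq_add_of_le' h.2
    rw [vpMult_eq_zero, sub_zero]
    have := hk2 h.1
    have h2 : (2 : ℤ) ^ (t + 2) = 4 * 2 ^ t := by ring
    rw [h2] at this
    rw [show t + 2 - 2 = t by omega]
    push_cast
    omega

lemma dyadicMult_eq_zero {low : Prop} {s : ℕ} {k : ℤ} (hk : 2 ^ (s + 1) ≤ |k|) :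
    dyadicMult low s k = 0 := by
  have h2 : (2 : ℤ) ^ (s - 2) ≤ 2 ^ s := pow_le_pow_right₀ (by norm_num) (by omega)
  have h3 : (2 : ℤ) ^ (s + 1) = 2 * 2 ^ s := by ring
  rw [dyadicMult, vpMult_eq_zero (by push_cast; omega), vpMult_eq_zero (by push_cast; omega)]
  simp

lemma dyadicMult_eq_zero_of_le {s : ℕ} (hs : 2 ≤ s) {k : ℤ}
    (hk : |k| ≤ 2 ^ (s - 2)) : dyadicMult False s k = 0 := by
  have h2 : (2 : ℤ) ^ (s - 2) ≤ 2 ^ s := pow_le_pow_right₀ (by norm_num) (by omega)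
  rw [dyadicMult, if_neg (by simp; omega), vpMult_eq_one (by positivity) (by push_cast; omega),
    vpMult_eq_one (by positivity) (by push_cast; omega), sub_self]

lemma integral_norm_dyadicKernel_le (low : Prop) (s : ℕ) :
    ∫ x : AddCircle (2 * π),
      ‖∑ k ∈ Finset.Ioo (-2 ^ (s + 1) : ℤ) (2 ^ (s + 1)),
        (dyadicMult low s k : ℂ) * fourier k x‖ ≤ 8 * π := by
  have hint : ∀ f : AddCircle (2 * π) → ℝ, Continuous f → Integrable f := fun f hf =>
    hf.integrable_of_hasCompactSupport (HasCompactSupport.of_compactSpace _)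
  set E := Finset.Ioo (-2 ^ (s + 1) : ℤ) (2 ^ (s + 1)) with hE
  have hE1 : ∀ t ≤ s, Finset.Ioo (-2 * (2 ^ t : ℕ) : ℤ) (2 * (2 ^ t : ℕ)) ⊆ E := by
    intro t ht
    have h2 : (2 : ℤ) ^ t ≤ 2 ^ s := pow_le_pow_right₀ (by norm_num) ht
    have h3 : (2 : ℤ) ^ (s + 1) = 2 * 2 ^ s := by ring
    refine Finset.Ioo_subset_Ioo ?_ ?_ <;> push_cast <;> omega
  have b1 := integral_norm_vpKernel_le (N := 2 ^ s) (by positivity) (hE1 s le_rfl)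
  have b2 := integral_norm_vpKernel_le (N := 2 ^ (s - 2)) (by positivity) (hE1 (s - 2) (by omega))
  have hpw : ∀ x : AddCircle (2 * π), ‖∑ k ∈ E, (dyadicMult low s k : ℂ) * fourier k x‖ ≤
      ‖∑ k ∈ E, (vpMult (2 ^ s) k : ℂ) * fourier k x‖ +
        ‖∑ k ∈ E, (vpMult (2 ^ (s - 2)) k : ℂ) * fourier k x‖ := by
    intro x
    by_cases h : low ∨ s < 2
    · simp only [dyadicMult, if_pos h, sub_zero]
      exact le_add_of_nonneg_right (norm_nonneg _)
    · simp only [dyadicMult, if_neg h, Complex.ofReal_sub, sub_mul, Finset.sum_sub_distrib]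
      exact norm_sub_le _ _
  refine (integral_mono (hint _ (by fun_prop)) (hint _ (by fun_prop)) hpw).trans ?_
  rw [integral_add (hint _ (by fun_prop)) (hint _ (by fun_prop))]
  linarith

/-- The multivariate dyadic multiplier. -/
def blockMult {d : ℕ} (j₀ : Fin d) (s : Fin d → ℕ) (k : Fin d → ℤ) : ℝ :=
  ∏ j, dyadicMult (j = j₀) (s j) (k j)

/-- The box carrying the frequencies of `blockMult`. -/
def freqBox {d : ℕ} (s : Fin d → ℕ) : Finset (Fin d → ℤ) :=
  Fintype.piFinset fun j => Finset.Ioo (-2 ^ (s j + 1) : ℤ) (2 ^ (s j + 1))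

lemma abs_blockMult_le {d : ℕ} (j₀ : Fin d) (s : Fin d → ℕ) (k : Fin d → ℤ) :
    |blockMult j₀ s k| ≤ 1 := by
  rw [blockMult, Finset.abs_prod]
  exact Finset.prod_le_one (fun _ _ => abs_nonneg _) fun _ _ => abs_dyadicMult_le _ _ _

lemma blockMult_eq_zero {d : ℕ} {j₀ : Fin d} {s : Fin d → ℕ} {k : Fin d → ℤ}
    (hk : k ∉ freqBox s) : blockMult j₀ s k = 0 := by
  simp only [freqBox, Fintype.mem_piFinset, not_forall, Finset.mem_Ioo, ← abs_lt, not_lt] at hk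
  obtain ⟨j, hj⟩ := hk
  exact Finset.prod_eq_zero (Finset.mem_univ j) (dyadicMult_eq_zero hj)

/-- Smooth dyadic block of a function. -/
def smoothBlock {d : ℕ} (j₀ : Fin d) (s : Fin d → ℕ) (g : Torus d → ℂ) : C(Torus d, ℂ) :=
  trigPoly (freqBox s) fun k => blockMult j₀ s k * fCoeff g k

lemma prod_dyadicKernel {d : ℕ} (j₀ : Fin d) (s : Fin d → ℕ) (x : Torus d) :
    ∏ j, ∑ k ∈ Finset.Ioo (-2 ^ (s j + 1) : ℤ) (2 ^ (s j + 1)),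
        (dyadicMult (j = j₀) (s j) k : ℂ) * fourier k (x j) =
      trigPoly (freqBox s) (fun k => (blockMult j₀ s k : ℂ)) x := by
  rw [Finset.prod_univ_sum, trigPoly_apply, freqBox]
  refine Finset.sum_congr rfl fun k _ => ?_
  rw [Finset.prod_mul_distrib, blockMult, trigChar_apply]
  push_cast; rfl

lemma integral_norm_blockKernel_le {d : ℕ} (j₀ : Fin d) (s : Fin d → ℕ) :
    ∫ x : Torus d, ‖trigPoly (freqBox s) (fun k => (blockMult j₀ s k : ℂ)) x‖ ≤ (8 * π) ^ d := by
  simp only [← prod_dyadicKernel, norm_prod]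
  rw [integral_fintype_prod_volume_eq_prod (fun j (t : AddCircle (2 * π)) =>
    ‖∑ k ∈ Finset.Ioo (-2 ^ (s j + 1) : ℤ) (2 ^ (s j + 1)),
        (dyadicMult (j = j₀) (s j) k : ℂ) * fourier k t‖)]
  refine (Finset.prod_le_prod (fun j _ => integral_nonneg fun _ => norm_nonneg _)
    fun j _ => integral_norm_dyadicKernel_le _ _).trans_eq ?_
  simp

lemma smoothBlock_apply {d : ℕ} (j₀ : Fin d) (s : Fin d → ℕ) {g : Torus d → ℂ}
    (hg : Integrable g) (x : Torus d) :
    smoothBlock j₀ s g x = (((2 * π) ^ d)⁻¹ : ℝ) *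
      ∫ y, trigPoly (freqBox s) (fun k => (blockMult j₀ s k : ℂ)) (x - y) * g y := by
  have h1 : ∀ y, trigPoly (freqBox s) (fun k => (blockMult j₀ s k : ℂ)) (x - y) * g y =
      ∑ k ∈ freqBox s, ((blockMult j₀ s k : ℂ) * trigChar k x) * (conj (trigChar k y) * g y) := by
    intro y
    rw [trigPoly_apply, Finset.sum_mul]
    exact Finset.sum_congr rfl fun k _ => by rw [trigChar_sub_arg]; ring
  simp only [h1]
  rw [integral_finsetSum _ fun k _ => (integrable_conj_trigChar_mul hg k).const_mul _,
    smoothBlock, trigPoly_apply, Finset.mul_sum]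
  refine Finset.sum_congr rfl fun k _ => ?_
  rw [integral_const_mul, fCoeff, Complex.real_smul]
  ring

lemma norm_smoothBlock_le {d : ℕ} (j₀ : Fin d) (s : Fin d → ℕ) {g : Torus d → ℂ}
    (hg : Integrable g) {A : ℝ} (hA : ∀ x, ‖g x‖ ≤ A) (x : Torus d) :
    ‖smoothBlock j₀ s g x‖ ≤ 4 ^ d * A := by
  have hA0 : 0 ≤ A := (norm_nonneg _).trans (hA 0)
  have hpi : (0 : ℝ) < (2 * π) ^ d := by positivity
  set K := trigPoly (freqBox s) (fun k => (blockMult j₀ s k : ℂ)) with hK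
  rw [smoothBlock_apply j₀ s hg, norm_mul, Complex.norm_real, norm_inv,
    Real.norm_of_nonneg hpi.le, inv_mul_le_iff₀ hpi]
  have iK : Integrable fun y => ‖K (x - y)‖ := integrable_of_continuous (by fun_prop)
  have hsymm : ∀ y, ‖K (x - y)‖ = ‖K (y - x)‖ := by
    intro y
    rw [← RCLike.norm_conj, hK, trigPoly_apply, trigPoly_apply, map_sum]
    congr 1
    refine Finset.sum_congr rfl fun k _ => ?_
    rw [trigChar_sub_arg, trigChar_sub_arg]
    simp only [map_mul, Complex.conj_ofReal, Complex.conj_conj]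
    ring
  calc ‖∫ y, K (x - y) * g y‖ ≤ ∫ y, ‖K (x - y) * g y‖ := norm_integral_le_integral_norm _
    _ ≤ ∫ y, ‖K (x - y)‖ * A := by
        refine integral_mono_of_nonneg (Filter.Eventually.of_forall fun y => norm_nonneg _)
          (iK.mul_const A) (Filter.Eventually.of_forall fun y => ?_)
        simp only [norm_mul]
        exact mul_le_mul_of_nonneg_left (hA y) (norm_nonneg _)
    _ = (∫ y, ‖K y‖) * A := by
        simp only [hsymm]
        rw [integral_mul_const, integral_sub_right_eq_self (fun y => ‖K y‖) x]
    _ ≤ (8 * π) ^ d * A := by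
        gcongr; exact integral_norm_blockKernel_le j₀ s
    _ = (2 * π) ^ d * (4 ^ d * A) := by
        rw [← mul_assoc, ← mul_pow]; ring_nf

/-! ### Combinatorics of the step hyperbolic cross -/

lemma abs_lt_two_pow_iff (s : ℕ) (k : ℤ) : |k| < 2 ^ s ↔ Nat.size k.natAbs ≤ s := by
  rw [Nat.size_le, Int.abs_eq_natAbs]
  exact_mod_cast Iff.rfl

lemma two_pow_half_le_abs_iff (s : ℕ) (k : ℤ) : 2 ^ s / 2 ≤ |k| ↔ s ≤ Nat.size k.natAbs := by
  rw [Int.abs_eq_natAbs]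
  cases s with
  | zero => simp
  | succ s =>
    rw [Nat.succ_le_iff, Nat.lt_size, pow_succ, Int.mul_ediv_cancel _ (by norm_num)]
    exact_mod_cast Iff.rfl

/-- Level vectors with `‖s‖₁ = n`. -/
def levels (d n : ℕ) : Finset (Fin d → ℕ) := Finset.piAntidiag Finset.univ n

lemma mem_levels {d n : ℕ} {s : Fin d → ℕ} : s ∈ levels d n ↔ ∑ j, s j = n := by
  simp [levels]

/-- Frequencies in the box of level `s`, which is dyadic in all directions except `j₀`. -/
def blockSet {d : ℕ} (j₀ : Fin d) (s : Fin d → ℕ) : Finset (Fin d → ℤ) :=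
  (freqBox s).filter fun k => ∀ j, (if j = j₀ then 0 else 2 ^ s j / 2 : ℤ) ≤ |k j| ∧ |k j| < 2 ^ s j

lemma mem_freqBox {d : ℕ} {s : Fin d → ℕ} {k : Fin d → ℤ} :
    k ∈ freqBox s ↔ ∀ j, |k j| < 2 ^ (s j + 1) := by
  simp only [freqBox, Fintype.mem_piFinset, Finset.mem_Ioo, abs_lt]

lemma mem_blockSet {d : ℕ} {j₀ : Fin d} {s : Fin d → ℕ} {k : Fin d → ℤ} :
    k ∈ blockSet j₀ s ↔
      ∀ j, (if j = j₀ then 0 else 2 ^ s j / 2 : ℤ) ≤ |k j| ∧ |k j| < 2 ^ s j := by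
  rw [blockSet, Finset.mem_filter, and_iff_right_iff_imp]
  intro h
  rw [mem_freqBox]
  intro j
  exact (h j).2.trans_le (pow_le_pow_right₀ (by norm_num) (by omega))

lemma mem_blockSet_iff_size {d : ℕ} {j₀ : Fin d} {s : Fin d → ℕ} {k : Fin d → ℤ} :
    k ∈ blockSet j₀ s ↔
      Nat.size (k j₀).natAbs ≤ s j₀ ∧ ∀ j ≠ j₀, s j = Nat.size (k j).natAbs := by
  rw [mem_blockSet]
  constructor
  · intro h
    refine ⟨(abs_lt_two_pow_iff _ _).1 (h j₀).2, fun j hj => ?_⟩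
    have := h j
    rw [if_neg hj, abs_lt_two_pow_iff, two_pow_half_le_abs_iff] at this
    omega
  · rintro ⟨h0, h⟩ j
    by_cases hj : j = j₀
    · subst hj
      rw [if_pos rfl, abs_lt_two_pow_iff]
      exact ⟨abs_nonneg _, h0⟩
    · rw [if_neg hj, abs_lt_two_pow_iff, two_pow_half_le_abs_iff, h j hj]
      exact ⟨le_rfl, le_rfl⟩

lemma mem_hypCross_iff {d n : ℕ} {k : Fin d → ℤ} :
    k ∈ hypCross d n ↔ ∑ j, Nat.size (k j).natAbs ≤ n := by
  have hrho : ∀ s : Fin d → ℕ, inRho s k ↔ s = fun j => Nat.size (k j).natAbs := by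
    intro s
    rw [inRho, funext_iff]
    refine forall_congr' fun j => ?_
    rw [abs_lt_two_pow_iff, two_pow_half_le_abs_iff]
    omega
  simp only [hypCross, Finset.mem_filter, Finset.mem_Icc, hrho]
  constructor
  · rintro ⟨-, s, hs, rfl⟩; exact hs
  · intro h
    have hk : ∀ j, |k j| ≤ 2 ^ n := fun j => ((abs_lt_two_pow_iff n (k j)).2
      ((Finset.single_le_sum (f := fun j => Nat.size (k j).natAbs) (fun _ _ => Nat.zero_le _)
        (Finset.mem_univ j)).trans h)).le
    exact ⟨⟨fun j => (abs_le.1 (hk j)).1, fun j => (abs_le.1 (hk j)).2⟩, _, h, rfl⟩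

lemma levels_eq_of_eq_off {d n : ℕ} {j₀ : Fin d} {s t : Fin d → ℕ} (hs : s ∈ levels d n)
    (ht : t ∈ levels d n) (h : ∀ j ≠ j₀, s j = t j) : s = t := by
  rw [mem_levels, ← Finset.add_sum_erase _ _ (Finset.mem_univ j₀)] at hs ht
  have : ∑ j ∈ Finset.univ.erase j₀, s j = ∑ j ∈ Finset.univ.erase j₀, t j :=
    Finset.sum_congr rfl fun j hj => h j (Finset.ne_of_mem_erase hj)
  ext j
  by_cases hj : j = j₀
  · subst hj; omega
  · exact h j hj

lemma pairwiseDisjoint_blockSet {d n : ℕ} (j₀ : Fin d) :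
    (levels d n : Set (Fin d → ℕ)).PairwiseDisjoint (blockSet j₀) := by
  intro s hs t ht hst
  rw [Function.onFun, Finset.disjoint_left]
  intro k hk hk'
  rw [mem_blockSet_iff_size] at hk hk'
  exact hst (levels_eq_of_eq_off hs ht fun j hj => (hk.2 j hj).trans (hk'.2 j hj).symm)

lemma hypCross_eq_biUnion {d n : ℕ} (j₀ : Fin d) :
    hypCross d n = (levels d n).biUnion (blockSet j₀) := by
  ext k
  rw [mem_hypCross_iff, Finset.mem_biUnion]
  have hsplit := Finset.add_sum_erase Finset.univ (fun j => Nat.size (k j).natAbs)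
    (Finset.mem_univ j₀)
  constructor
  · intro h
    refine ⟨fun j => if j = j₀ then n - ∑ j ∈ Finset.univ.erase j₀, Nat.size (k j).natAbs
      else Nat.size (k j).natAbs, ?_, ?_⟩
    · rw [mem_levels, ← Finset.add_sum_erase _ _ (Finset.mem_univ j₀), if_pos rfl,
        Finset.sum_congr rfl fun j hj => if_neg (Finset.ne_of_mem_erase hj)]
      omega
    · rw [mem_blockSet_iff_size]
      refine ⟨?_, fun j hj => if_neg hj⟩
      rw [if_pos rfl]
      omega
  · rintro ⟨s, hs, hk⟩
    rw [mem_blockSet_iff_size] at hk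
    rw [mem_levels] at hs
    rw [← hs]
    refine Finset.sum_le_sum fun j _ => ?_
    by_cases hj : j = j₀
    · subst hj; exact hk.1
    · exact (hk.2 j hj).ge

lemma sum_hypCross {d n : ℕ} (j₀ : Fin d) {β : Type*} [AddCommMonoid β] (F : (Fin d → ℤ) → β) :
    ∑ k ∈ hypCross d n, F k = ∑ s ∈ levels d n, ∑ k ∈ blockSet j₀ s, F k := by
  rw [hypCross_eq_biUnion j₀, Finset.sum_biUnion (pairwiseDisjoint_blockSet j₀)]

lemma blockMult_eq_one {d : ℕ} {j₀ : Fin d} {s : Fin d → ℕ} {k : Fin d → ℤ}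
    (hk : k ∈ blockSet j₀ s) : blockMult j₀ s k = 1 := by
  rw [mem_blockSet] at hk
  refine Finset.prod_eq_one fun j _ => dyadicMult_eq_one (hk j).2 fun hj => ?_
  have := (hk j).1
  rwa [if_neg hj] at this

lemma card_levels_filter_le {d n : ℕ} (j₀ : Fin d) (B : Fin d → Finset ℕ) {b : ℕ}
    (hB : ∀ j, (B j).card ≤ b) :
    ((levels d n).filter fun s => ∀ j ≠ j₀, s j ∈ B j).card ≤ b ^ (d - 1) := by
  have h1 : ((levels d n).filter fun s => ∀ j ≠ j₀, s j ∈ B j).card ≤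
      (Fintype.piFinset fun j => if j = j₀ then {0} else B j).card := by
    refine Finset.card_le_card_of_injOn (fun s j => if j = j₀ then 0 else s j) ?_ ?_
    · intro s hs
      rw [Finset.mem_coe, Finset.mem_filter] at hs
      rw [Finset.mem_coe, Fintype.mem_piFinset]
      intro j
      by_cases hj : j = j₀
      · simp [hj]
      · simpa [hj] using hs.2 j hj
    · intro s hs t ht hst
      rw [Finset.mem_coe, Finset.mem_filter] at hs ht
      refine levels_eq_of_eq_off hs.1 ht.1 (j₀ := j₀) fun j hj => ?_
      have := congrFun hst j
      simpa [hj] using this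
  refine h1.trans ?_
  rw [Fintype.card_piFinset, ← Finset.mul_prod_erase _ _ (Finset.mem_univ j₀), if_pos rfl,
    Finset.card_singleton, one_mul]
  refine (Finset.prod_le_pow_card _ _ b fun j hj => ?_).trans_eq ?_
  · rw [if_neg (Finset.ne_of_mem_erase hj)]; exact hB j
  · rw [Finset.card_erase_of_mem (Finset.mem_univ _), Finset.card_univ, Fintype.card_fin]

lemma card_levels_le {d n : ℕ} (j₀ : Fin d) : (levels d n).card ≤ (n + 1) ^ (d - 1) := by
  have h := card_levels_filter_le (n := n) j₀ (fun _ => Finset.range (n + 1)) (b := n + 1)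
    (by simp)
  rwa [Finset.filter_true_of_mem] at h
  intro s hs j _
  rw [mem_levels] at hs
  rw [Finset.mem_range, Nat.lt_succ_iff, ← hs]
  exact Finset.single_le_sum (f := s) (fun _ _ => Nat.zero_le _) (Finset.mem_univ j)

lemma mem_of_dyadicMult_ne_zero {s : ℕ} {k : ℤ} (h : dyadicMult False s k ≠ 0) :
    s ∈ ({0, 1, Nat.size k.natAbs - 1, Nat.size k.natAbs, Nat.size k.natAbs + 1} : Finset ℕ) := by
  have h1 : |k| < 2 ^ (s + 1) := by
    by_contra hc
    exact h (dyadicMult_eq_zero (not_lt.1 hc))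
  rw [abs_lt_two_pow_iff] at h1
  simp only [Finset.mem_insert, Finset.mem_singleton]
  by_cases hs : 2 ≤ s
  · have h2 : ¬ |k| < 2 ^ (s - 2) := fun hc => h (dyadicMult_eq_zero_of_le hs hc.le)
    rw [abs_lt_two_pow_iff] at h2
    omega
  · omega

lemma sum_blockMult_sq_le {d n : ℕ} (j₀ : Fin d) (k : Fin d → ℤ) :
    ∑ s ∈ levels d n, blockMult j₀ s k ^ 2 ≤ 5 ^ (d - 1) := by
  have h := card_levels_filter_le (n := n) j₀ (fun j => {0, 1, Nat.size (k j).natAbs - 1,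
    Nat.size (k j).natAbs, Nat.size (k j).natAbs + 1}) (b := 5) fun j => Finset.card_le_five
  calc ∑ s ∈ levels d n, blockMult j₀ s k ^ 2
      ≤ ∑ s ∈ levels d n, if ∀ j ≠ j₀, s j ∈ ({0, 1, Nat.size (k j).natAbs - 1,
          Nat.size (k j).natAbs, Nat.size (k j).natAbs + 1} : Finset ℕ) then (1 : ℝ) else 0 := by
        refine Finset.sum_le_sum fun s _ => ?_
        split_ifs with hs
        · exact (sq_le_one_iff_abs_le_one _).2 (abs_blockMult_le j₀ s k)
        · push Not at hs
          obtain ⟨j, hj, hjs⟩ := hs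
          have : blockMult j₀ s k = 0 := by
            refine Finset.prod_eq_zero (Finset.mem_univ j) ?_
            by_contra hc
            refine hjs (mem_of_dyadicMult_ne_zero ?_)
            simpa only [hj] using hc
          simp [this]
    _ ≤ 5 ^ (d - 1) := by
        rw [← Finset.sum_filter, Finset.sum_const, nsmul_eq_mul, mul_one]
        exact_mod_cast h

/-- The union of the frequency boxes of level `n`. -/
def bigCross (d n : ℕ) : Finset (Fin d → ℤ) := (levels d n).biUnion freqBox

lemma freqBox_subset_bigCross {d n : ℕ} {s : Fin d → ℕ} (hs : s ∈ levels d n) :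
    freqBox s ⊆ bigCross d n := Finset.subset_biUnion_of_mem freqBox hs

lemma hypCross_subset_bigCross {d n : ℕ} (j₀ : Fin d) : hypCross d n ⊆ bigCross d n := by
  rw [hypCross_eq_biUnion j₀]
  exact Finset.biUnion_mono fun s _ => Finset.filter_subset _ _

lemma card_bigCross_le {d n : ℕ} (j₀ : Fin d) :
    (bigCross d n).card ≤ (n + 1) ^ (d - 1) * (4 ^ d * 2 ^ n) := by
  refine Finset.card_biUnion_le.trans ?_
  refine (Finset.sum_le_card_nsmul _ _ (4 ^ d * 2 ^ n) fun s hs => ?_).trans ?_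
  · rw [mem_levels] at hs
    rw [freqBox, Fintype.card_piFinset, ← hs, ← Finset.prod_pow_eq_pow_sum]
    have : (4 : ℕ) ^ d = ∏ _j : Fin d, 4 := by simp
    rw [this, ← Finset.prod_mul_distrib]
    refine Finset.prod_le_prod' fun j _ => ?_
    rw [Int.card_Ioo]
    have h2 : (2 : ℤ) ^ (s j + 1) = 2 * 2 ^ s j := by ring
    have h3 : ((2 ^ s j : ℕ) : ℤ) = 2 ^ s j := by push_cast; rfl
    omega
  · rw [smul_eq_mul]
    exact Nat.mul_le_mul_right _ (card_levels_le j₀)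

lemma abs_le_of_mem_bigCross {d n : ℕ} {k : Fin d → ℤ} (hk : k ∈ bigCross d n) (j : Fin d) :
    |(k j : ℝ)| ≤ 2 ^ (n + 1) := by
  obtain ⟨s, hs, hks⟩ := Finset.mem_biUnion.1 hk
  rw [mem_levels] at hs
  have h1 := mem_freqBox.1 hks j
  have h2 : s j ≤ n := hs ▸ Finset.single_le_sum (f := s) (fun _ _ => Nat.zero_le _)
    (Finset.mem_univ j)
  have h3 : |k j| ≤ 2 ^ (n + 1) := h1.le.trans (pow_le_pow_right₀ (by norm_num) (by omega))
  exact_mod_cast h3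

/-! ### Truncations and level sums -/

/-- Truncation of a function at height `t`. -/
def lowPart {d : ℕ} (g : Torus d → ℂ) (t : ℝ) (x : Torus d) : ℂ := if ‖g x‖ ≤ t then g x else 0

/-- The part of a function above height `t`. -/
def highPart {d : ℕ} (g : Torus d → ℂ) (t : ℝ) (x : Torus d) : ℂ := if ‖g x‖ ≤ t then 0 else g x

lemma lowPart_add_highPart {d : ℕ} (g : Torus d → ℂ) (t : ℝ) (x : Torus d) :
    lowPart g t x + highPart g t x = g x := by
  rw [lowPart, highPart]; split_ifs <;> simp

lemma norm_lowPart_le {d : ℕ} (g : Torus d → ℂ) {t : ℝ} (ht : 0 ≤ t) (x : Torus d) :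
    ‖lowPart g t x‖ ≤ t := by
  rw [lowPart]; split_ifs with h
  · exact h
  · simpa using ht

lemma norm_lowPart_le_norm {d : ℕ} (g : Torus d → ℂ) (t : ℝ) (x : Torus d) :
    ‖lowPart g t x‖ ≤ ‖g x‖ := by
  rw [lowPart]; split_ifs <;> simp

lemma stronglyMeasurable_lowPart {d : ℕ} {g : Torus d → ℂ} (hg : StronglyMeasurable g) (t : ℝ) :
    StronglyMeasurable (lowPart g t) :=
  StronglyMeasurable.ite (measurableSet_le hg.norm.measurable measurable_const) hg
    stronglyMeasurable_const

lemma stronglyMeasurable_highPart {d : ℕ} {g : Torus d → ℂ} (hg : StronglyMeasurable g) (t : ℝ) :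
    StronglyMeasurable (highPart g t) :=
  StronglyMeasurable.ite (measurableSet_le hg.norm.measurable measurable_const)
    stronglyMeasurable_const hg

lemma integrable_lowPart {d : ℕ} {g : Torus d → ℂ} (hg : StronglyMeasurable g) {t : ℝ}
    (ht : 0 ≤ t) : Integrable (lowPart g t) :=
  Integrable.of_bound (stronglyMeasurable_lowPart hg t).aestronglyMeasurable t
    (Filter.Eventually.of_forall fun x => norm_lowPart_le g ht x)

lemma norm_highPart_sq_le {d : ℕ} (g : Torus d → ℂ) {t r : ℝ} (ht : 0 < t) (hr : 2 ≤ r)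
    (x : Torus d) : ‖highPart g t x‖ ^ 2 ≤ t ^ (2 - r) * ‖g x‖ ^ r := by
  rw [highPart]; split_ifs with h
  · simp only [norm_zero, ne_eq, OfNat.ofNat_ne_zero, not_false_eq_true, zero_pow]
    positivity
  · push Not at h
    have hg : 0 < ‖g x‖ := ht.trans h
    have h1 : ‖g x‖ ^ (2 - r) ≤ t ^ (2 - r) :=
      rpow_le_rpow_of_nonpos ht h.le (by linarith)
    calc ‖g x‖ ^ 2 = ‖g x‖ ^ (2 - r) * ‖g x‖ ^ r := by
          rw [← rpow_add hg, ← rpow_natCast]; norm_num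
      _ ≤ _ := by gcongr

lemma memLp_highPart {d : ℕ} {g : Torus d → ℂ} (hg : StronglyMeasurable g) {t r : ℝ}
    (ht : 0 < t) (hr : 2 ≤ r) (hi : Integrable fun x => ‖g x‖ ^ r) :
    MemLp (highPart g t) 2 := by
  have hm := (stronglyMeasurable_highPart hg t).aestronglyMeasurable (μ := volume)
  rw [memLp_two_iff_integrable_sq_norm hm]
  refine (hi.const_mul (t ^ (2 - r))).mono' (hm.norm.pow 2)
    (Filter.Eventually.of_forall fun x => ?_)
  rw [norm_of_nonneg (by positivity)]
  exact norm_highPart_sq_le g ht hr x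

lemma integral_highPart_sq_le {d : ℕ} {g : Torus d → ℂ} {t r : ℝ}
    (ht : 0 < t) (hr : 2 ≤ r) (hi : Integrable fun x => ‖g x‖ ^ r) :
    ∫ x, ‖highPart g t x‖ ^ 2 ≤ t ^ (2 - r) * ∫ x, ‖g x‖ ^ r := by
  rw [← integral_const_mul]
  exact integral_mono_of_nonneg (Filter.Eventually.of_forall fun x => by positivity)
    (hi.const_mul _) (Filter.Eventually.of_forall fun x => norm_highPart_sq_le g ht hr x)

lemma smoothBlock_add {d : ℕ} (j₀ : Fin d) (s : Fin d → ℕ) {f g : Torus d → ℂ}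
    (hf : Integrable f) (hg : Integrable g) (x : Torus d) :
    smoothBlock j₀ s (fun x => f x + g x) x = smoothBlock j₀ s f x + smoothBlock j₀ s g x := by
  simp only [smoothBlock, trigPoly_apply, fCoeff_add hf hg, ← Finset.sum_add_distrib]
  exact Finset.sum_congr rfl fun k _ => by ring

lemma sum_integral_smoothBlock_sq_le {d n : ℕ} (j₀ : Fin d) {b : Torus d → ℂ} (hb : MemLp b 2) :
    ∑ s ∈ levels d n, ∫ x, ‖smoothBlock j₀ s b x‖ ^ 2 ≤ 5 ^ (d - 1) * ∫ x, ‖b x‖ ^ 2 := by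
  have h1 : ∀ s ∈ levels d n, ∫ x, ‖smoothBlock j₀ s b x‖ ^ 2 ≤
      (2 * π) ^ d * ∑ k ∈ bigCross d n, blockMult j₀ s k ^ 2 * ‖fCoeff b k‖ ^ 2 := by
    intro s hs
    rw [smoothBlock, integral_norm_trigPoly_sq]
    gcongr
    refine (Finset.sum_le_sum_of_subset_of_nonneg (freqBox_subset_bigCross hs)
      fun _ _ _ => by positivity).trans_eq ?_
    refine Finset.sum_congr rfl fun k _ => ?_
    rw [norm_mul, mul_pow, Complex.norm_real, norm_eq_abs, sq_abs]
  refine (Finset.sum_le_sum h1).trans ?_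
  rw [← Finset.mul_sum, Finset.sum_comm]
  simp only [← Finset.sum_mul]
  calc (2 * π) ^ d * ∑ k ∈ bigCross d n, (∑ s ∈ levels d n, blockMult j₀ s k ^ 2) *
        ‖fCoeff b k‖ ^ 2
      ≤ (2 * π) ^ d * ∑ k ∈ bigCross d n, 5 ^ (d - 1) * ‖fCoeff b k‖ ^ 2 := by
        gcongr with k _
        exact sum_blockMult_sq_le j₀ k
    _ = 5 ^ (d - 1) * ((2 * π) ^ d * ∑ k ∈ bigCross d n, ‖fCoeff b k‖ ^ 2) := by
        rw [← Finset.mul_sum]; ring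
    _ ≤ _ := by gcongr; exact sum_norm_fCoeff_sq_le hb _

lemma pow_le_sum_levels {q : ℕ} (hq : 2 ≤ q) {c l U : ℝ} (hc : 0 ≤ c) (hl : 0 < l) (hU : 0 ≤ U)
    (hUl : U ≤ c * l) (N : ℕ) :
    U ^ q ≤ 4 * (4 * c) ^ (q - 2) * ∑ j ∈ Finset.range N,
      (l / 2 ^ (j + 1)) ^ (q - 2) * max 0 (U - c * (l / 2 ^ (j + 1))) ^ 2 +
        (2 * c * (l / 2 ^ N)) ^ q := by
  set S : ℕ → ℝ := fun N => ∑ j ∈ Finset.range N,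
      (l / 2 ^ (j + 1)) ^ (q - 2) * max 0 (U - c * (l / 2 ^ (j + 1))) ^ 2 with hS
  have hS0 : ∀ N, 0 ≤ S N := fun N => Finset.sum_nonneg fun j _ => by positivity
  have key : U ^ q ≤ 4 * (4 * c) ^ (q - 2) * S N ∨ U ≤ 2 * c * (l / 2 ^ N) := by
    induction N with
    | zero => right; simp only [pow_zero, div_one]; nlinarith [mul_nonneg hc hl.le]
    | succ N ih =>
      have hsucc : S (N + 1) = S N + (l / 2 ^ (N + 1)) ^ (q - 2) *
          max 0 (U - c * (l / 2 ^ (N + 1))) ^ 2 := Finset.sum_range_succ _ _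
      rcases ih with ih | ih
      · left
        refine ih.trans ?_
        rw [hsucc]
        gcongr
        exact le_add_of_nonneg_right (by positivity)
      · by_cases h : U ≤ 2 * c * (l / 2 ^ (N + 1))
        · right; exact h
        · left
          push Not at h
          set t := l / 2 ^ (N + 1) with ht
          have ht2 : l / 2 ^ N = 2 * t := by rw [ht, pow_succ]; field_simp
          rw [ht2] at ih
          have ht0 : 0 < t := by positivity
          have h1 : U / 2 ≤ max 0 (U - c * t) := le_max_of_le_right (by linarith)
          have h2 : (U / 2) ^ 2 ≤ max 0 (U - c * t) ^ 2 := by gcongr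
          calc U ^ q = U ^ (q - 2) * U ^ 2 := by rw [← pow_add]; congr 1; omega
            _ ≤ (4 * c * t) ^ (q - 2) * (4 * max 0 (U - c * t) ^ 2) := by
                gcongr
                · linarith
                · linarith
            _ = 4 * (4 * c) ^ (q - 2) * (t ^ (q - 2) * max 0 (U - c * t) ^ 2) := by
                rw [mul_pow (4 * c)]; ring
            _ ≤ _ := by
                rw [hsucc]
                gcongr
                exact le_add_of_nonneg_left (hS0 N)
  rcases key with h | h
  · exact h.trans (le_add_of_nonneg_right (by positivity))
  · have := pow_le_pow_left₀ hU h q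
    have h2 : 0 ≤ 4 * (4 * c) ^ (q - 2) * S N := mul_nonneg (by positivity) (hS0 N)
    linarith

lemma integral_norm_lowPart_rpow_le {d : ℕ} {f : Torus d → ℂ} (hf : StronglyMeasurable f) {t p : ℝ}
    (hp : 0 ≤ p) (hi : Integrable fun x => ‖f x‖ ^ p) :
    (Integrable fun x => ‖lowPart f t x‖ ^ p) ∧
      ∫ x, ‖lowPart f t x‖ ^ p ≤ ∫ x, ‖f x‖ ^ p := by
  have h1 : ∀ x, ‖lowPart f t x‖ ^ p ≤ ‖f x‖ ^ p := fun x =>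
    rpow_le_rpow (norm_nonneg _) (norm_lowPart_le_norm f t x) hp
  have h2 : Integrable fun x => ‖lowPart f t x‖ ^ p := by
    refine hi.mono' ?_ (Filter.Eventually.of_forall fun x => ?_)
    · exact ((stronglyMeasurable_lowPart hf t).norm.measurable.pow_const p).aestronglyMeasurable
    · rw [norm_of_nonneg (by positivity)]; exact h1 x
  exact ⟨h2, integral_mono h2 hi h1⟩

lemma sum_integral_smoothBlock_excess_le {d n : ℕ} (j₀ : Fin d) {g : Torus d → ℂ}
    (hg : StronglyMeasurable g) {p t : ℝ} (hp : 2 ≤ p) (ht : 0 < t)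
    (hi : Integrable fun x => ‖g x‖ ^ p) (h1 : ∫ x, ‖g x‖ ^ p ≤ 1) :
    ∑ s ∈ levels d n, ∫ x, max 0 (‖smoothBlock j₀ s g x‖ - 4 ^ d * t) ^ 2 ≤
      5 ^ (d - 1) * t ^ (2 - p) := by
  have hm := memLp_highPart hg ht hp hi
  have hlow := integrable_lowPart hg ht.le
  have hhigh : Integrable (highPart g t) := hm.integrable (by norm_num)
  calc ∑ s ∈ levels d n, ∫ x, max 0 (‖smoothBlock j₀ s g x‖ - 4 ^ d * t) ^ 2
      ≤ ∑ s ∈ levels d n, ∫ x, ‖smoothBlock j₀ s (highPart g t) x‖ ^ 2 := by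
        refine Finset.sum_le_sum fun s _ => integral_mono
          (integrable_of_continuous (by fun_prop)) (integrable_of_continuous (by fun_prop))
          fun x => ?_
        have h2 := smoothBlock_add j₀ s hlow hhigh x
        simp only [lowPart_add_highPart] at h2
        have h3 := norm_smoothBlock_le j₀ s hlow (norm_lowPart_le g ht.le) x
        have h4 : ‖smoothBlock j₀ s g x‖ ≤ ‖smoothBlock j₀ s (lowPart g t) x‖ +
            ‖smoothBlock j₀ s (highPart g t) x‖ := by
          rw [h2]; exact norm_add_le _ _
        have h5 : max 0 (‖smoothBlock j₀ s g x‖ - 4 ^ d * t) ≤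
            ‖smoothBlock j₀ s (highPart g t) x‖ := max_le (norm_nonneg _) (by linarith)
        have h6 := le_max_left 0 (‖smoothBlock j₀ s g x‖ - 4 ^ d * t)
        show max 0 (‖smoothBlock j₀ s g x‖ - 4 ^ d * t) ^ 2 ≤ _
        gcongr
    _ ≤ 5 ^ (d - 1) * ∫ x, ‖highPart g t x‖ ^ 2 := sum_integral_smoothBlock_sq_le j₀ hm
    _ ≤ 5 ^ (d - 1) * t ^ (2 - p) := by
        gcongr
        refine (integral_highPart_sq_le ht hp hi).trans ?_
        exact mul_le_of_le_one_right (by positivity) h1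

lemma sum_range_half_pow_le (N : ℕ) : ∑ j ∈ Finset.range N, (1 / 2 : ℝ) ^ (j + 1) ≤ 1 := by
  have : ∑ j ∈ Finset.range N, (1 / 2 : ℝ) ^ (j + 1) = 1 - (1 / 2) ^ N := by
    induction N with
    | zero => simp
    | succ N ih => rw [Finset.sum_range_succ, ih]; ring
  rw [this]
  have : (0 : ℝ) ≤ (1 / 2) ^ N := by positivity
  linarith

/-- A Marcinkiewicz type estimate: the smoothed blocks of a bounded function with `L_p` norm at
most one are controlled in `L_q`, summed over all levels, for every `q ≥ p + 1`. -/
lemma sum_integral_smoothBlock_pow_le {d n q : ℕ} (j₀ : Fin d) {g : Torus d → ℂ}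
    (hg : StronglyMeasurable g) {p l : ℝ} (hp : 2 ≤ p) (hq : p + 1 ≤ q) (hl : 0 < l)
    (hgl : ∀ x, ‖g x‖ ≤ l)
    (hi : Integrable fun x => ‖g x‖ ^ p) (h1 : ∫ x, ‖g x‖ ^ p ≤ 1) :
    ∑ s ∈ levels d n, ∫ x, ‖smoothBlock j₀ s g x‖ ^ q ≤
      (4 * (4 * 4 ^ d) ^ (q - 2) * 5 ^ (d - 1) + 1) * l ^ (q - p) := by
  have hq2 : 2 ≤ q := by
    have : (2 : ℝ) ≤ q := by linarith
    exact_mod_cast this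
  have hgi : Integrable g := Integrable.of_bound hg.aestronglyMeasurable l
    (Filter.Eventually.of_forall hgl)
  have hlq : 0 < l ^ (q - p) := rpow_pos_of_pos hl _
  set V : ℝ := (volume : Measure (Torus d)).real Set.univ with hV
  have hV0 : 0 ≤ V := measureReal_nonneg
  obtain ⟨N, hN⟩ : ∃ N : ℕ, ((levels d n).card : ℝ) * (V * (2 * 4 ^ d * (l / 2 ^ N)) ^ q) ≤
      l ^ (q - p) := by
    set B : ℝ := ((levels d n).card : ℝ) * (V * (2 * 4 ^ d * l) ^ q) with hB
    have hB0 : 0 ≤ B := by positivity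
    obtain ⟨N, hN⟩ := exists_pow_lt_of_lt_one (show 0 < l ^ (q - p) / (B + 1) by positivity)
      (show (1 / 2 : ℝ) < 1 by norm_num)
    refine ⟨N, ?_⟩
    rw [lt_div_iff₀ (by positivity)] at hN
    have h3 : (2 * 4 ^ d * (l / 2 ^ N)) ^ q = (2 * 4 ^ d * l) ^ q * ((1 / 2) ^ N) ^ q := by
      rw [← mul_pow]; congr 1; rw [one_div, inv_pow]; ring
    have h4 : ((1 / 2 : ℝ) ^ N) ^ q ≤ (1 / 2) ^ N :=
      pow_le_of_le_one (by positivity) (pow_le_one₀ (by norm_num) (by norm_num)) (by omega)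
    calc _ = ((1 / 2 : ℝ) ^ N) ^ q * B := by rw [h3, hB]; ring
      _ ≤ (1 / 2) ^ N * (B + 1) := by gcongr; linarith
      _ ≤ _ := hN.le
  have hpt : ∀ s, ∫ x, ‖smoothBlock j₀ s g x‖ ^ q ≤ 4 * (4 * 4 ^ d) ^ (q - 2) *
      (∑ j ∈ Finset.range N, (l / 2 ^ (j + 1)) ^ (q - 2) *
        (∫ x, max 0 (‖smoothBlock j₀ s g x‖ - 4 ^ d * (l / 2 ^ (j + 1))) ^ 2)) +
          V * (2 * 4 ^ d * (l / 2 ^ N)) ^ q := by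
    intro s
    have h3 : ∀ x, ‖smoothBlock j₀ s g x‖ ^ q ≤ 4 * (4 * 4 ^ d) ^ (q - 2) *
        (∑ j ∈ Finset.range N, (l / 2 ^ (j + 1)) ^ (q - 2) *
          max 0 (‖smoothBlock j₀ s g x‖ - 4 ^ d * (l / 2 ^ (j + 1))) ^ 2) +
            (2 * 4 ^ d * (l / 2 ^ N)) ^ q := fun x =>
      pow_le_sum_levels hq2 (by positivity) hl (norm_nonneg _)
        (norm_smoothBlock_le j₀ s hgi hgl x) N
    refine (integral_mono (integrable_of_continuous (by fun_prop))
      (integrable_of_continuous (by fun_prop)) h3).trans_eq ?_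
    rw [integral_add (integrable_of_continuous (by fun_prop)) (integrable_const _),
      integral_const_mul, integral_finsetSum _ fun j _ => integrable_of_continuous (by fun_prop),
      integral_const, smul_eq_mul]
    simp only [integral_const_mul]
    rfl
  calc ∑ s ∈ levels d n, ∫ x, ‖smoothBlock j₀ s g x‖ ^ q
      ≤ ∑ s ∈ levels d n, (4 * (4 * 4 ^ d) ^ (q - 2) *
      (∑ j ∈ Finset.range N, (l / 2 ^ (j + 1)) ^ (q - 2) *
        (∫ x, max 0 (‖smoothBlock j₀ s g x‖ - 4 ^ d * (l / 2 ^ (j + 1))) ^ 2)) +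
          V * (2 * 4 ^ d * (l / 2 ^ N)) ^ q) := Finset.sum_le_sum fun s _ => hpt s
    _ = 4 * (4 * 4 ^ d) ^ (q - 2) * (∑ j ∈ Finset.range N, (l / 2 ^ (j + 1)) ^ (q - 2) *
        (∑ s ∈ levels d n,
          ∫ x, max 0 (‖smoothBlock j₀ s g x‖ - 4 ^ d * (l / 2 ^ (j + 1))) ^ 2)) +
          (levels d n).card * (V * (2 * 4 ^ d * (l / 2 ^ N)) ^ q) := by
        rw [Finset.sum_add_distrib, ← Finset.mul_sum, Finset.sum_comm, Finset.sum_const,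
          nsmul_eq_mul]
        simp only [Finset.mul_sum]
    _ ≤ 4 * (4 * 4 ^ d) ^ (q - 2) * (∑ j ∈ Finset.range N, (l / 2 ^ (j + 1)) ^ (q - 2) *
        (5 ^ (d - 1) * (l / 2 ^ (j + 1)) ^ (2 - p))) + l ^ (q - p) := by
        gcongr with j _
        exact sum_integral_smoothBlock_excess_le j₀ hg hp (by positivity) hi h1
    _ ≤ 4 * (4 * 4 ^ d) ^ (q - 2) * (∑ j ∈ Finset.range N,
        5 ^ (d - 1) * (l ^ (q - p) * (1 / 2) ^ (j + 1))) + l ^ (q - p) := by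
        refine add_le_add (mul_le_mul_of_nonneg_left (Finset.sum_le_sum fun j _ => ?_)
          (by positivity)) le_rfl
        have ht : 0 < l / 2 ^ (j + 1) := by positivity
        have h3 : (l / 2 ^ (j + 1)) ^ (q - 2) * (5 ^ (d - 1) * (l / 2 ^ (j + 1)) ^ (2 - p)) =
            5 ^ (d - 1) * (l / 2 ^ (j + 1)) ^ (q - p) := by
          rw [← rpow_natCast (l / 2 ^ (j + 1)) (q - 2), mul_left_comm, ← rpow_add ht]
          congr 2
          push_cast [hq2]; ring
        rw [h3]
        gcongr
        rw [div_eq_mul_one_div, mul_rpow hl.le (by positivity)]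
        gcongr
        rw [← one_div_pow]
        refine (rpow_le_rpow_of_exponent_ge (by positivity)
          (pow_le_one₀ (by norm_num) (by norm_num)) (show (1 : ℝ) ≤ q - p by linarith)).trans_eq ?_
        rw [rpow_one]
    _ = 4 * (4 * 4 ^ d) ^ (q - 2) * (5 ^ (d - 1) * (l ^ (q - p) *
        ∑ j ∈ Finset.range N, (1 / 2) ^ (j + 1))) + l ^ (q - p) := by
        simp only [Finset.mul_sum]
    _ ≤ 4 * (4 * 4 ^ d) ^ (q - 2) * (5 ^ (d - 1) * (l ^ (q - p) * 1)) + l ^ (q - p) := by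
        gcongr
        exact sum_range_half_pow_le N
    _ = _ := by ring

/-! ### The decomposition -/

/-- The block projection of `f` at level `s`. -/
def blockPart {d : ℕ} (j₀ : Fin d) (s : Fin d → ℕ) (f : Torus d → ℂ) : C(Torus d, ℂ) :=
  trigPoly (blockSet j₀ s) (fCoeff f)

lemma smoothBlock_blockPart {d : ℕ} (j₀ : Fin d) (s : Fin d → ℕ) (f : Torus d → ℂ) (x : Torus d) :
    smoothBlock j₀ s (blockPart j₀ s f) x = blockPart j₀ s f x := by
  rw [smoothBlock, blockPart, trigPoly_apply, trigPoly_apply]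
  have hsub : blockSet j₀ s ⊆ freqBox s := Finset.filter_subset _ _
  refine (Finset.sum_subset hsub fun k _ hk => ?_).symm.trans
    (Finset.sum_congr rfl fun k hk => ?_)
  · rw [fCoeff_trigPoly, if_neg hk]; simp
  · rw [fCoeff_trigPoly, if_pos hk, blockMult_eq_one hk]; simp

lemma exists_integral_blockPart_le (d K : ℕ) : ∃ C : ℝ, 0 < C ∧ ∀ (j₀ : Fin d) (s : Fin d → ℕ)
    (f : Torus d → ℂ), ∫ x, ‖blockPart j₀ s f x‖ ^ 2 ^ (K + 1) ≤
      C * ∫ x, ‖smoothBlock j₀ s f x‖ ^ 2 ^ (K + 1) := by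
  obtain ⟨C, hC, h⟩ := exists_projBound_box d K
  refine ⟨C, hC, fun j₀ s f => ?_⟩
  set c : (Fin d → ℤ) → ℂ := fun k => blockMult j₀ s k * fCoeff f k
  have h1 := h (fun j => if j = j₀ then 0 else 2 ^ s j / 2) (fun j => 2 ^ s j)
    (blockPart j₀ s f) (trigPoly_mem_trigSpan (fun k hk => mem_blockSet.1 hk) _)
    (trigPoly (freqBox s \ blockSet j₀ s) c) (trigPoly_mem_trigSpan (fun k hk hk' =>
      (Finset.mem_sdiff.1 hk).2 (mem_blockSet.2 hk')) _)
  refine h1.trans_eq ?_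
  congr 2
  ext x
  congr 2
  rw [smoothBlock, blockPart, trigPoly_apply, trigPoly_apply, trigPoly_apply, add_comm,
    ← Finset.sum_sdiff (Finset.filter_subset _ _ : blockSet j₀ s ⊆ freqBox s)]
  congr 1
  exact Finset.sum_congr rfl fun k hk => by rw [blockMult_eq_one hk]; simp

lemma sum_smoothBlock_eq_trigPoly {d n : ℕ} (j₀ : Fin d) (h : (Fin d → ℕ) → Torus d → ℂ)
    (x : Torus d) : ∑ s ∈ levels d n, smoothBlock j₀ s (h s) x =
      trigPoly (bigCross d n)
        (fun k => ∑ s ∈ levels d n, blockMult j₀ s k * fCoeff (h s) k) x := by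
  rw [trigPoly_apply]
  simp only [Finset.sum_mul]
  rw [Finset.sum_comm]
  refine Finset.sum_congr rfl fun s hs => ?_
  rw [smoothBlock, trigPoly_apply]
  exact Finset.sum_subset (freqBox_subset_bigCross hs) fun k _ hk => by
    rw [blockMult_eq_zero hk]; simp

lemma norm_sq_add_sum_le {ι : Type*} (S : Finset ι) (z : ℂ) (a : ι → ℝ) (w : ι → ℂ) {B : ℝ}
    (hB : ∑ s ∈ S, a s ^ 2 ≤ B) :
    ‖z + ∑ s ∈ S, a s * w s‖ ^ 2 ≤ 2 * ‖z‖ ^ 2 + 2 * B * ∑ s ∈ S, ‖w s‖ ^ 2 := by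
  have h1 : ‖∑ s ∈ S, (a s : ℂ) * w s‖ ≤ ∑ s ∈ S, |a s| * ‖w s‖ := by
    refine (norm_sum_le _ _).trans_eq (Finset.sum_congr rfl fun s _ => ?_)
    rw [norm_mul, Complex.norm_real, norm_eq_abs]
  have h2 : (∑ s ∈ S, |a s| * ‖w s‖) ^ 2 ≤ B * ∑ s ∈ S, ‖w s‖ ^ 2 := by
    refine (Finset.sum_mul_sq_le_sq_mul_sq S _ _).trans ?_
    simp only [sq_abs]
    gcongr
  have h3 : ‖∑ s ∈ S, (a s : ℂ) * w s‖ ^ 2 ≤ B * ∑ s ∈ S, ‖w s‖ ^ 2 :=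
    (pow_le_pow_left₀ (norm_nonneg _) h1 2).trans h2
  have h4 := norm_add_le z (∑ s ∈ S, (a s : ℂ) * w s)
  have h5 : ‖z + ∑ s ∈ S, (a s : ℂ) * w s‖ ^ 2 ≤ (‖z‖ + ‖∑ s ∈ S, (a s : ℂ) * w s‖) ^ 2 := by
    gcongr
  nlinarith [sq_nonneg (‖z‖ - ‖∑ s ∈ S, (a s : ℂ) * w s‖)]

/-- The hyperbolic cross projection of a function with `L_p` norm at most one splits into a
trigonometric polynomial with small coefficients and a uniformly small remainder. -/
lemma exists_decomposition {d : ℕ} (j₀ : Fin d) {p : ℝ} (hp : 2 ≤ p) :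
    ∃ C : ℝ, 0 < C ∧ ∀ (n : ℕ) (l : ℝ), 0 < l → ∀ f : Torus d → ℂ, StronglyMeasurable f →
      (Integrable fun x => ‖f x‖ ^ p) → ∫ x, ‖f x‖ ^ p ≤ 1 →
      ∃ c : (Fin d → ℤ) → ℂ, ∑ k ∈ bigCross d n, ‖c k‖ ^ 2 ≤ C * l ^ (2 - p) ∧
        ∀ x, ‖trigPoly (hypCross d n) (fCoeff f) x - trigPoly (bigCross d n) c x‖ ≤
          C * (n + 1) ^ (d - 1) * l := by
  obtain ⟨K, hK⟩ : ∃ K : ℕ, p + 1 ≤ ((2 ^ (K + 1) : ℕ) : ℝ) := by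
    obtain ⟨K, hK⟩ := pow_unbounded_of_one_lt (p + 1) (one_lt_two (α := ℝ))
    refine ⟨K, ?_⟩
    push_cast
    rw [pow_succ]
    have : (0 : ℝ) ≤ 2 ^ K := by positivity
    linarith
  obtain ⟨C₁, hC₁, hblock⟩ := exists_integral_blockPart_le d K
  set q : ℕ := 2 ^ (K + 1) with hq
  set C₂ : ℝ := 4 * (4 * 4 ^ d) ^ (q - 2) * 5 ^ (d - 1) + 1 with hC₂
  have hC₂0 : 0 < C₂ := by positivity
  refine ⟨4 ^ d + (2 + 2 * 5 ^ (d - 1) * (C₁ * C₂)), by positivity, ?_⟩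
  intro n l hl f hf hfi hf1
  have hlow := integrable_lowPart hf hl.le
  have hhighm := memLp_highPart hf hl hp hfi
  have hhigh : Integrable (highPart f l) := hhighm.integrable (by norm_num)
  set g : (Fin d → ℕ) → C(Torus d, ℂ) := fun s => blockPart j₀ s (lowPart f l) with hg
  have hgm : ∀ s, StronglyMeasurable (g s) := fun s => (map_continuous (g s)).stronglyMeasurable
  have hgi : ∀ s, Integrable fun x => ‖g s x‖ ^ (q : ℝ) := fun s => by
    simp only [rpow_natCast]
    exact integrable_of_continuous (by fun_prop)
  have hq2 : (2 : ℝ) ≤ q := by linarith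
  have hgq : ∑ s ∈ levels d n, ∫ x, ‖g s x‖ ^ (q : ℝ) ≤ C₁ * (C₂ * l ^ (q - p)) := by
    simp only [rpow_natCast]
    obtain ⟨h1, h2⟩ := integral_norm_lowPart_rpow_le (t := l) hf (by linarith) hfi
    refine (Finset.sum_le_sum fun s _ => hblock j₀ s (lowPart f l)).trans ?_
    rw [← Finset.mul_sum]
    gcongr
    exact sum_integral_smoothBlock_pow_le j₀ (stronglyMeasurable_lowPart hf l) hp hK hl
      (norm_lowPart_le f hl.le) h1 (h2.trans hf1)
  have hhs : ∀ s, MemLp (highPart (g s) l) 2 := fun s => memLp_highPart (hgm s) hl hq2 (hgi s)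
  refine ⟨fun k => (if k ∈ hypCross d n then fCoeff (highPart f l) k else 0) +
    ∑ s ∈ levels d n, blockMult j₀ s k * fCoeff (highPart (g s) l) k, ?_, ?_⟩
  · have hpi : (1 : ℝ) ≤ (2 * π) ^ d := one_le_pow₀ (by linarith [pi_gt_three])
    have hbessel : ∀ b : Torus d → ℂ, MemLp b 2 →
        ∑ k ∈ bigCross d n, ‖fCoeff b k‖ ^ 2 ≤ ∫ x, ‖b x‖ ^ 2 := fun b hb =>
      (le_mul_of_one_le_left (Finset.sum_nonneg fun _ _ => by positivity) hpi).trans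
        (sum_norm_fCoeff_sq_le hb _)
    calc ∑ k ∈ bigCross d n, ‖(if k ∈ hypCross d n then fCoeff (highPart f l) k else 0) +
          ∑ s ∈ levels d n, blockMult j₀ s k * fCoeff (highPart (g s) l) k‖ ^ 2
        ≤ ∑ k ∈ bigCross d n, (2 * ‖fCoeff (highPart f l) k‖ ^ 2 + 2 * 5 ^ (d - 1) *
            ∑ s ∈ levels d n, ‖fCoeff (highPart (g s) l) k‖ ^ 2) := by
          refine Finset.sum_le_sum fun k _ =>
            (norm_sq_add_sum_le _ _ _ _ (sum_blockMult_sq_le j₀ k)).trans ?_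
          gcongr
          split_ifs <;> simp
      _ = 2 * ∑ k ∈ bigCross d n, ‖fCoeff (highPart f l) k‖ ^ 2 + 2 * 5 ^ (d - 1) *
            ∑ s ∈ levels d n, ∑ k ∈ bigCross d n, ‖fCoeff (highPart (g s) l) k‖ ^ 2 := by
          rw [Finset.sum_add_distrib, ← Finset.mul_sum, ← Finset.mul_sum, Finset.sum_comm]
      _ ≤ 2 * l ^ (2 - p) + 2 * 5 ^ (d - 1) *
            ∑ s ∈ levels d n, l ^ (2 - (q : ℝ)) * ∫ x, ‖g s x‖ ^ (q : ℝ) := by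
          refine add_le_add (mul_le_mul_of_nonneg_left ?_ (by norm_num))
            (mul_le_mul_of_nonneg_left (Finset.sum_le_sum fun s _ => ?_) (by positivity))
          · exact (hbessel _ hhighm).trans ((integral_highPart_sq_le hl hp hfi).trans
              (mul_le_of_le_one_right (by positivity) hf1))
          · exact (hbessel _ (hhs s)).trans (integral_highPart_sq_le hl hq2 (hgi s))
      _ ≤ 2 * l ^ (2 - p) + 2 * 5 ^ (d - 1) *
            (l ^ (2 - (q : ℝ)) * (C₁ * (C₂ * l ^ (q - p)))) := by
          rw [← Finset.mul_sum]
          gcongr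
      _ = (2 + 2 * 5 ^ (d - 1) * (C₁ * C₂)) * l ^ (2 - p) := by
          have : l ^ (2 - p) = l ^ (2 - (q : ℝ)) * l ^ (q - p) := by
            rw [← rpow_add hl]; congr 1; ring
          rw [this]; ring
      _ ≤ _ := by
          refine mul_le_mul_of_nonneg_right ?_ (by positivity)
          exact le_add_of_nonneg_left (by positivity)
  · intro x
    have h1 : trigPoly (hypCross d n) (fCoeff f) x =
        ∑ k ∈ hypCross d n, fCoeff (highPart f l) k * trigChar k x +
          ∑ s ∈ levels d n, g s x := by
      have h2 : ∀ k, fCoeff f k = fCoeff (highPart f l) k + fCoeff (lowPart f l) k := by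
        intro k
        rw [add_comm, ← fCoeff_add hlow hhigh]
        simp only [lowPart_add_highPart]
      rw [trigPoly_apply]
      simp only [h2, add_mul, Finset.sum_add_distrib]
      rw [sum_hypCross j₀ fun k => fCoeff (lowPart f l) k * trigChar k x]
      simp only [hg, blockPart, trigPoly_apply]
    have h3 : ∀ s, g s x = smoothBlock j₀ s (lowPart (g s) l) x +
        smoothBlock j₀ s (highPart (g s) l) x := by
      intro s
      rw [← smoothBlock_add j₀ s (integrable_lowPart (hgm s) hl.le)
        ((hhs s).integrable (by norm_num))]
      simp only [lowPart_add_highPart]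
      exact (smoothBlock_blockPart j₀ s _ x).symm
    have h4 : trigPoly (bigCross d n)
        (fun k => (if k ∈ hypCross d n then fCoeff (highPart f l) k else 0) +
          ∑ s ∈ levels d n, blockMult j₀ s k * fCoeff (highPart (g s) l) k) x =
        ∑ k ∈ hypCross d n, fCoeff (highPart f l) k * trigChar k x +
          ∑ s ∈ levels d n, smoothBlock j₀ s (highPart (g s) l) x := by
      rw [sum_smoothBlock_eq_trigPoly, trigPoly_apply, trigPoly_apply]
      simp only [add_mul, Finset.sum_add_distrib, ite_mul, zero_mul]
      rw [← Finset.sum_filter, Finset.filter_mem_eq_inter,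
        Finset.inter_eq_right.2 (hypCross_subset_bigCross j₀)]
    rw [h1, h4, Finset.sum_congr rfl fun s _ => h3 s, Finset.sum_add_distrib]
    rw [show ∀ a b c : ℂ, a + (b + c) - (a + c) = b from fun a b c => by ring]
    have hcard : ((levels d n).card : ℝ) ≤ (n + 1) ^ (d - 1) := by
      exact_mod_cast card_levels_le (n := n) j₀
    calc ‖∑ s ∈ levels d n, smoothBlock j₀ s (lowPart (g s) l) x‖
        ≤ ∑ s ∈ levels d n, 4 ^ d * l := norm_sum_le_of_le _ fun s _ =>
          norm_smoothBlock_le j₀ s (integrable_lowPart (hgm s) hl.le)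
            (norm_lowPart_le (g s) hl.le) x
      _ = (levels d n).card * (4 ^ d * l) := by rw [Finset.sum_const, nsmul_eq_mul]
      _ ≤ (n + 1) ^ (d - 1) * (4 ^ d * l) := by gcongr
      _ = 4 ^ d * (n + 1) ^ (d - 1) * l := by ring
      _ ≤ _ := by
          gcongr
          exact le_add_of_nonneg_right (by positivity)

/-! ### The Kolmogorov numbers -/

lemma norm_toLinfty_le {d : ℕ} (g : C(Torus d, ℂ)) {ε : ℝ} (hε : 0 ≤ ε) (h : ∀ x, ‖g x‖ ≤ ε) :
    ‖toLinfty g‖ ≤ ε := by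
  have h1 : ∀ᵐ x ∂(volume : Measure (Torus d)), ‖toLinfty g x‖ ≤ ε :=
    (ContinuousMap.coeFn_toLp (p := ∞) (𝕜 := ℂ) (volume : Measure (Torus d)) g).mono fun x hx => by
      rw [toLinfty, hx]; exact h x
  simpa using Lp.norm_le_of_ae_bound hε h1

lemma dK_SE_le {d m : ℕ} {q : ℝ≥0∞} {E : Finset (Fin d → ℤ)} {ε : ℝ} (hε : 0 ≤ ε)
    (V : Submodule ℂ C(Torus d, ℂ)) [FiniteDimensional ℂ V] (hV : Module.finrank ℂ V < m)
    (h : ∀ f : Lp ℂ q (volume : Measure (Torus d)), ‖f‖ ≤ 1 →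
      ∃ b ∈ V, ∀ x, ‖trigPoly E (fCoeff f) x - b x‖ ≤ ε) : dK (SE d q E) m ≤ ε := by
  set W := V.map (ContinuousMap.toLp ∞ (volume : Measure (Torus d)) ℂ :
    C(Torus d, ℂ) →L[ℂ] Lp ℂ ∞ (volume : Measure (Torus d))).toLinearMap with hW
  have hWm : Module.finrank ℂ W < m := (Submodule.finrank_map_le _ _).trans_lt hV
  have hbdd : ∀ (L : Submodule ℂ (Lp ℂ ∞ (volume : Measure (Torus d)))) v,
      BddBelow (Set.range fun b : L => ‖v - (b : Lp ℂ ∞ (volume : Measure (Torus d)))‖) :=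
    fun L v => ⟨0, by rintro _ ⟨b, rfl⟩; exact norm_nonneg _⟩
  refine (ciInf_le ⟨0, ?_⟩ ⟨W, inferInstance, hWm⟩).trans ?_
  · rintro _ ⟨L, rfl⟩
    exact Real.iSup_nonneg fun a => Real.iInf_nonneg fun b => norm_nonneg _
  · refine Real.iSup_le (fun f => ?_) hε
    obtain ⟨b, hb, hfb⟩ := h f.1 f.2
    refine (ciInf_le (hbdd W _) ⟨toLinfty b, Submodule.mem_map_of_mem hb⟩).trans ?_
    have h1 : SE d q E f.1 - toLinfty b = toLinfty (trigPoly E (fCoeff f.1) - b) :=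
      (map_sub (ContinuousMap.toLp ∞ (volume : Measure (Torus d)) ℂ) _ _).symm
    show ‖SE d q E f.1 - toLinfty b‖ ≤ ε
    rw [h1]
    exact norm_toLinfty_le _ hε hfb

lemma integral_norm_rpow_le_one {d : ℕ} {p : ℝ} (hp : 0 < p)
    (f : Lp ℂ (ENNReal.ofReal p) (volume : Measure (Torus d))) (hf : ‖f‖ ≤ 1) :
    (Integrable fun x => ‖f x‖ ^ p) ∧ ∫ x, ‖f x‖ ^ p ≤ 1 := by
  have h0 : ENNReal.ofReal p ≠ 0 := by simpa using hp
  have hpr : (ENNReal.ofReal p).toReal = p := ENNReal.toReal_ofReal hp.le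
  have hm := Lp.memLp f
  have hi := hm.integrable_norm_rpow h0 ENNReal.ofReal_ne_top
  rw [hpr] at hi
  refine ⟨hi, ?_⟩
  have hnn : 0 ≤ ∫ x, ‖f x‖ ^ p := integral_nonneg fun x => by positivity
  rw [Lp.norm_def, hm.eLpNorm_eq_integral_rpow_norm h0 ENNReal.ofReal_ne_top, hpr,
    ENNReal.toReal_ofReal (by positivity)] at hf
  by_contra hc
  push Not at hc
  exact absurd hf (not_le.2 (one_lt_rpow hc (by positivity)))

lemma exists_grid_size {d n : ℕ} (j₀ : Fin d) (hn : 1 ≤ n) : ∃ P : ℕ, 0 < P ∧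
    4 * π * d * 2 ^ (n + 1) * (bigCross d n).card ≤ P ∧
    (P : ℝ) ^ d ≤ exp (((7 + 4 * d) * d : ℕ) * n) := by
  refine ⟨2 ^ ((7 + 4 * d) * n), by positivity, ?_, ?_⟩
  · have h1 : ((bigCross d n).card : ℝ) ≤ 2 ^ (n * d) * (4 ^ d * 2 ^ n) := by
      have h2 : (bigCross d n).card ≤ 2 ^ (n * d) * (4 ^ d * 2 ^ n) := by
        refine (card_bigCross_le j₀).trans ?_
        refine Nat.mul_le_mul_right _ ?_
        rw [pow_mul]
        calc (n + 1) ^ (d - 1) ≤ (2 ^ n) ^ (d - 1) := by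
              gcongr; exact Nat.lt_two_pow_self
          _ ≤ (2 ^ n) ^ d := Nat.pow_le_pow_right (by positivity) (Nat.sub_le d 1)
      exact_mod_cast h2
    have hd : (d : ℝ) ≤ 2 ^ d := by exact_mod_cast Nat.lt_two_pow_self.le
    have h4 : (4 : ℝ) ^ d = 2 ^ (2 * d) := by rw [pow_mul]; norm_num
    calc 4 * π * d * 2 ^ (n + 1) * ((bigCross d n).card : ℝ)
        ≤ 2 ^ 4 * 2 ^ d * 2 ^ (n + 1) * (2 ^ (n * d) * (4 ^ d * 2 ^ n)) := by
          gcongr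
          linarith [pi_le_four]
      _ = 2 ^ (5 + 3 * d + 2 * n + n * d) := by
          rw [h4]; simp only [← pow_add]; congr 1; ring
      _ ≤ 2 ^ ((7 + 4 * d) * n) := by
          refine pow_le_pow_right₀ (by norm_num) ?_
          nlinarith
      _ = _ := by push_cast; rfl
  · have h2 : (2 : ℝ) ≤ exp 1 := by linarith [add_one_le_exp (1 : ℝ)]
    calc ((2 ^ ((7 + 4 * d) * n) : ℕ) : ℝ) ^ d = 2 ^ ((7 + 4 * d) * d * n) := by
          push_cast; rw [← pow_mul]; congr 1; ring
      _ ≤ exp 1 ^ ((7 + 4 * d) * d * n) := by gcongr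
      _ = _ := by rw [← exp_nat_mul]; push_cast; rw [mul_one]

lemma sqrt_mul_balance {X N p D : ℝ} (hX : 0 < X) (hN : 0 < N) (hp : 0 < p) :
    √(X * (X ^ (1 / p) * N ^ (-(2 * D / p))) ^ (2 - p)) =
      X ^ (1 / p) * N ^ (D * (1 - 2 / p)) := by
  rw [sqrt_eq_iff_mul_self_eq (by positivity) (by positivity), mul_rpow (by positivity)
    (by positivity), ← rpow_mul hX.le, ← rpow_mul hN.le, ← mul_assoc,
    show X * X ^ (1 / p * (2 - p)) = X ^ (1 + 1 / p * (2 - p)) by rw [rpow_add hX, rpow_one],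
    mul_mul_mul_comm, ← rpow_add hX, ← rpow_add hN]
  congr 2 <;> field_simp <;> ring

lemma mul_balance {X N p D : ℝ} (hN : 0 < N) (hp : 0 < p) :
    N ^ D * (X ^ (1 / p) * N ^ (-(2 * D / p))) = X ^ (1 / p) * N ^ (D * (1 - 2 / p)) := by
  rw [mul_left_comm, ← rpow_add hN]
  congr 2
  field_simp
  ring

theorem stmt12 (d : ℕ) (hd : 1 ≤ d) (p : ℝ) (hp : 2 ≤ p) :
    ∃ C : ℝ, 0 < C ∧ ∀ n : ℕ, 1 ≤ n → ∀ m : ℕ, 1 ≤ m → m ≤ (hypCross d n).card →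
      dK (SE d (ENNReal.ofReal p) (hypCross d n)) m ≤
        C * ((2 ^ n : ℝ) / m) ^ (1 / p) *
          (n : ℝ) ^ ((d - 1 : ℝ) * (1 - 1 / p) + 1 / p) := by
  set j₀ : Fin d := ⟨0, hd⟩
  obtain ⟨C, hC, hdec⟩ := exists_decomposition j₀ hp
  have hp0 : 0 < p := by linarith
  set A : ℝ := 2 ^ (d - 1) * 4 ^ d
  set B : ℝ := (((7 + 4 * d) * d : ℕ) : ℝ)
  have hB : 1 ≤ B := by
    have : 1 ≤ (7 + 4 * d) * d := by nlinarith
    exact Nat.one_le_cast.2 this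
  refine ⟨C * 2 ^ (d - 1) + 2 * √(300000 * A * B * C), by positivity, ?_⟩
  intro n hn m hm _
  have hN1 : (1 : ℝ) ≤ n := by exact_mod_cast hn
  have hN0 : (0 : ℝ) < n := by linarith
  have hm0 : (0 : ℝ) < m := by exact_mod_cast hm
  set X : ℝ := 2 ^ n * (n : ℝ) ^ d / m with hX
  have hX0 : 0 < X := by positivity
  set l : ℝ := X ^ (1 / p) * (n : ℝ) ^ (-(2 * (d - 1 : ℝ) / p)) with hl
  have hl0 : 0 < l := by positivity
  set T : ℝ := X ^ (1 / p) * (n : ℝ) ^ ((d - 1 : ℝ) * (1 - 2 / p)) with hT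
  have hsqrt : √(X * l ^ (2 - p)) = T := sqrt_mul_balance hX0 hN0 hp0
  have hDcast : (n : ℝ) ^ (d - 1 : ℝ) = (n : ℝ) ^ (d - 1) := by
    rw [← rpow_natCast]; push_cast [hd]; rfl
  have hlin : (n : ℝ) ^ (d - 1) * l = T := by
    rw [← hDcast]; exact mul_balance hN0 hp0
  have hn2 : (n + 1 : ℝ) ^ (d - 1) ≤ 2 ^ (d - 1) * (n : ℝ) ^ (d - 1) := by
    rw [← mul_pow]; gcongr; linarith
  have hcard : ((bigCross d n).card : ℝ) ≤ A * (2 ^ n * (n : ℝ) ^ (d - 1)) := by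
    have h1 : ((bigCross d n).card : ℝ) ≤ (n + 1) ^ (d - 1) * (4 ^ d * 2 ^ n) := by
      exact_mod_cast card_bigCross_le (n := n) j₀
    calc _ ≤ _ := h1
      _ ≤ (2 ^ (d - 1) * (n : ℝ) ^ (d - 1)) * (4 ^ d * 2 ^ n) := by gcongr
      _ = _ := by ring
  obtain ⟨P, hP0, hPR, hPL⟩ := exists_grid_size j₀ hn
  obtain ⟨V, hVf, hVm, hV⟩ := exists_subspace_approx_trigPoly hm hP0
    (fun k hk j => abs_le_of_mem_bigCross hk j) hPR
    (show 1 ≤ B * n by nlinarith) hPL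
  have hbound : dK (SE d (ENNReal.ofReal p) (hypCross d n)) m ≤
      (C * 2 ^ (d - 1) + 2 * √(300000 * A * B * C)) * T := by
    refine dK_SE_le (by positivity) V hVm fun f hf => ?_
    obtain ⟨hfi, hf1⟩ := integral_norm_rpow_le_one hp0 f hf
    obtain ⟨c, hc, hcx⟩ := hdec n l hl0 f (Lp.stronglyMeasurable f) hfi hf1
    obtain ⟨b, hb, hbx⟩ := hV c
    refine ⟨b, hb, fun x => ?_⟩
    have h1 : C * (n + 1 : ℝ) ^ (d - 1) * l ≤ C * 2 ^ (d - 1) * T := by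
      calc _ ≤ C * (2 ^ (d - 1) * (n : ℝ) ^ (d - 1)) * l := by gcongr
        _ = C * 2 ^ (d - 1) * ((n : ℝ) ^ (d - 1) * l) := by ring
        _ = _ := by rw [hlin]
    have h2 : √(300000 * (bigCross d n).card * (B * n) / m) *
        √(∑ k ∈ bigCross d n, ‖c k‖ ^ 2) ≤ √(300000 * A * B * C) * T := by
      rw [← hsqrt, ← sqrt_mul (by positivity), ← sqrt_mul (by positivity)]
      refine sqrt_le_sqrt ?_
      calc 300000 * ((bigCross d n).card : ℝ) * (B * n) / m * ∑ k ∈ bigCross d n, ‖c k‖ ^ 2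
          ≤ 300000 * (A * (2 ^ n * (n : ℝ) ^ (d - 1))) * (B * n) / m * (C * l ^ (2 - p)) := by
            gcongr
        _ = 300000 * A * B * C * (2 ^ n * ((n : ℝ) ^ (d - 1) * n) / m * l ^ (2 - p)) := by ring
        _ = _ := by rw [← pow_succ, Nat.sub_add_cancel hd, hX]
    calc ‖trigPoly (hypCross d n) (fCoeff f) x - b x‖
        ≤ ‖trigPoly (hypCross d n) (fCoeff f) x - trigPoly (bigCross d n) c x‖ +
          ‖trigPoly (bigCross d n) c x - b x‖ := norm_sub_le_norm_sub_add_norm_sub _ _ _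
      _ ≤ _ := by linarith [hcx x, hbx x]
  refine hbound.trans_eq ?_
  rw [mul_assoc (C * 2 ^ (d - 1) + 2 * √(300000 * A * B * C))]
  congr 1
  rw [hT, hX, mul_div_right_comm, mul_rpow (by positivity) (by positivity), mul_assoc,
    ← rpow_natCast (n : ℝ) d, ← rpow_mul hN0.le, ← rpow_add hN0]
  congr 2
  field_simp
  ring

end
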